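/- arXiv:0712.0331 — 2 statements merged into one kernel-verified Lean document; each statement's English description precedes it below -/
import Mathlib

section
/- Fix an integer r ≥ 1 and positive integers l_1, ..., l_r. For every real ε > 0 there exists N such that for all integers n_1, ..., n_r with 1 < n_1 | n_2 | ... | n_r, ω(n_i) = l_i for every i, gcd(n_i, n_r/n_i) = 1 for every i, and P^-(n_r) ≥ N, one has D(C_{n_1} ⊕ ... ⊕ C_{n_r}) ≤ (Σ_{i=1}^r l_i + ε)·n_r. -/
open scoped BigOperators

attribute [local instance] Classical.propDecidable

/-- A sequence (multiset) over `G` is zero-sumfree if no nonempty sub-multiset sums to `0`. -/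
def IsZeroSumFree {G : Type*} [AddCommGroup G] (S : Multiset G) : Prop :=
  ∀ T : Multiset G, T ≤ S → T ≠ 0 → T.sum ≠ 0

/-- A minimal zero-sum sequence: sum `0`, and no nonempty proper sub-multiset sums to `0`. -/
def IsMinimalZeroSum {G : Type*} [AddCommGroup G] (S : Multiset G) : Prop :=
  S.sum = 0 ∧ ∀ T : Multiset G, T < S → T ≠ 0 → T.sum ≠ 0

/-- The cross number of a sequence: `k(S) = Σ_{g ∈ S} 1/ord(g)`. -/
noncomputable def crossNumber {G : Type*} [AddCommGroup G] (S : Multiset G) : ℝ :=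
  (S.map fun g => (1 : ℝ) / (addOrderOf g)).sum

/-- The little cross number `k(G)`: max of `k(S)` over zero-sumfree sequences `S` over `G`. -/
noncomputable def littleCrossNumber (G : Type*) [AddCommGroup G] : ℝ :=
  sSup {x : ℝ | ∃ S : Multiset G, IsZeroSumFree S ∧ crossNumber S = x}

/-- The cross number `K(G)`: max of `k(S)` over minimal zero-sum sequences `S` over `G`. -/
noncomputable def bigCrossNumber (G : Type*) [AddCommGroup G] : ℝ :=
  sSup {x : ℝ | ∃ S : Multiset G, IsMinimalZeroSum S ∧ crossNumber S = x}

/-- The Davenport constant `D(G)`. -/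
noncomputable def davenport (G : Type*) [AddCommGroup G] : ℕ :=
  sInf {t | 1 ≤ t ∧ ∀ S : Multiset G, t ≤ Multiset.card S →
    ∃ T, T ≤ S ∧ T ≠ 0 ∧ T.sum = 0}

/-- The constant `η(G)`. -/
noncomputable def etaConst (G : Type*) [AddCommGroup G] : ℕ :=
  sInf {t | 1 ≤ t ∧ ∀ S : Multiset G, t ≤ Multiset.card S →
    ∃ T, T ≤ S ∧ T ≠ 0 ∧ Multiset.card T ≤ AddMonoid.exponent G ∧ T.sum = 0}

/-- `υ_i(d',d) = A_i / gcd(A_i, B_i)` where `A_i = gcd(d', n_i)` and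
`B_i = lcm(d, n_i)/lcm(d', n_i)`. -/
def upsilon (ni d' d : ℕ) : ℕ :=
  Nat.gcd d' ni / Nat.gcd (Nat.gcd d' ni) (Nat.lcm d ni / Nat.lcm d' ni)

/-- `k*` of `C_{n_1} ⊕ ... ⊕ C_{n_r}`, computed from the primary decomposition. -/
noncomputable def kStarTuple {r : ℕ} (n : Fin r → ℕ) : ℝ :=
  ∑ i, ∑ p ∈ (n i).primeFactors,
    ((p ^ ((n i).factorization p) : ℝ) - 1) / (p ^ ((n i).factorization p))

/-- `α(n) = Σ_{d | n} (P⁻(d) − 1)/d`. -/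
noncomputable def alphaFn (n : ℕ) : ℝ :=
  ∑ d ∈ n.divisors, ((d.minFac : ℝ) - 1) / d

/-- `β(n) = Σ_{p | n prime} (p − 1)/p`. -/
noncomputable def betaFn (n : ℕ) : ℝ :=
  ∑ p ∈ n.primeFactors, ((p : ℝ) - 1) / p

/-- The number of elements of `Y` that the translation by `v` moves out of `Y`. -/
noncomputable def exitCard {V : Type*} [AddCommGroup V] (Y : Finset V) (v : V) : ℕ :=
  (Y.filter fun y => y + v ∉ Y).card

section Translation

variable {V : Type*} [AddCommGroup V] (Y : Finset V)

lemma exitCard_zero : exitCard Y 0 = 0 := by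
  simp [exitCard]

lemma exitCard_add_le (v w : V) : exitCard Y (v + w) ≤ exitCard Y v + exitCard Y w := by
  unfold exitCard
  have hsub : (Y.filter fun y => y + (v + w) ∉ Y) ⊆
      (Y.filter fun y => y + v ∉ Y) ∪ (Y.filter fun y => y + w ∉ Y).image (fun y => y - v) := by
    intro y hy
    simp only [Finset.mem_filter, Finset.mem_union, Finset.mem_image] at hy ⊢
    by_cases h : y + v ∈ Y
    · right
      exact ⟨y + v, ⟨h, by simpa [add_assoc] using hy.2⟩, by simp⟩
    · exact Or.inl ⟨hy.1, h⟩
  calc _ ≤ _ := Finset.card_le_card hsub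
    _ ≤ _ := Finset.card_union_le _ _
    _ ≤ _ := Nat.add_le_add_left Finset.card_image_le _

lemma exitCard_nsmul_le (j : ℕ) (v : V) : exitCard Y (j • v) ≤ j * exitCard Y v := by
  induction j with
  | zero => simp [exitCard_zero]
  | succ j ih =>
    rw [succ_nsmul, add_mul, one_mul]
    exact (exitCard_add_le Y _ _).trans (Nat.add_le_add_right ih _)

lemma card_filter_add_mem_add_exitCard (v : V) :
    (Y.filter fun y => y + v ∈ Y).card + exitCard Y v = Y.card :=
  Finset.card_filter_add_card_filter_not _

lemma card_add_exitCard_le_card_union (a b : V) :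
    Y.card + exitCard Y (b - a) ≤
      (Y.image (fun y => y + a) ∪ Y.image (fun y => y + b)).card := by
  have hsub : Y.image (fun y => y + a) ∪
      (Y.filter fun y => y + (b - a) ∉ Y).image (fun y => y + b) ⊆
      Y.image (fun y => y + a) ∪ Y.image (fun y => y + b) :=
    Finset.union_subset_union_right (Finset.image_subset_image (Finset.filter_subset _ _))
  refine le_trans (le_of_eq ?_) (Finset.card_le_card hsub)
  rw [Finset.card_union_of_disjoint, Finset.card_image_of_injective _ (add_left_injective a),
    Finset.card_image_of_injective _ (add_left_injective b), exitCard]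
  rw [Finset.disjoint_left]
  intro x hx hx'
  simp only [Finset.mem_image, Finset.mem_filter] at hx hx'
  obtain ⟨y, hy, rfl⟩ := hx
  obtain ⟨z, ⟨-, hz⟩, h⟩ := hx'
  apply hz
  have : z + (b - a) = y := by rw [← add_sub_assoc, h, add_sub_cancel_right]
  rwa [this]

end Translation

section Fourier

variable {V : Type*} [AddCommGroup V] [Fintype V]

lemma sum_addChar_norm_sq_mul (Y : Finset V) (v : V) :
    ∑ ψ : AddChar V ℂ, ((‖∑ y ∈ Y, ψ y‖ ^ 2 : ℝ) : ℂ) * ψ v =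
      Fintype.card V * (Y.filter fun y => y + v ∈ Y).card := by
  have h1 : ∀ ψ : AddChar V ℂ, ((‖∑ y ∈ Y, ψ y‖ ^ 2 : ℝ) : ℂ) * ψ v =
      ∑ y ∈ Y, ∑ z ∈ Y, ψ (y + v - z) := by
    intro ψ
    rw [Complex.ofReal_pow, ← Complex.mul_conj', map_sum, Finset.sum_mul_sum, Finset.sum_mul]
    refine Finset.sum_congr rfl fun y _ => ?_
    rw [Finset.sum_mul]
    refine Finset.sum_congr rfl fun z _ => ?_
    rw [sub_eq_add_neg, AddChar.map_add_eq_mul, AddChar.map_add_eq_mul, AddChar.map_neg_eq_conj]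
    ring
  simp_rw [h1]
  rw [Finset.sum_comm]
  simp_rw [Finset.sum_comm (s := Finset.univ) (t := Y), AddChar.sum_apply_eq_ite, sub_eq_zero]
  rw [Finset.card_filter, Nat.cast_sum, Finset.mul_sum]
  refine Finset.sum_congr rfl fun y _ => ?_
  rw [Finset.sum_ite_eq]
  simp

lemma norm_geom_sum_le_of_le_norm_sub_one {z : ℂ} (hz : ‖z‖ = 1) {J : ℕ} (hJ : 0 < J)
    (h : 8 / (J : ℝ) ≤ ‖z - 1‖) : ‖∑ j ∈ Finset.range J, z ^ j‖ ≤ J / 4 := by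
  have hJ' : (0 : ℝ) < J := by exact_mod_cast hJ
  have hpos : 0 < ‖z - 1‖ := lt_of_lt_of_le (by positivity) h
  have hne : z ≠ 1 := by
    rintro rfl
    simp at hpos
  rw [geom_sum_eq hne, norm_div, div_le_iff₀ hpos]
  have h1 : ‖z ^ J - 1‖ ≤ 2 := by
    refine (norm_sub_le _ _).trans ?_
    rw [norm_pow, hz]
    norm_num
  rw [div_le_iff₀ hJ'] at h
  nlinarith

lemma norm_sum_geom_sum_le {ι : Type*} (A : Finset ι) (a : ι → V) (ψ : AddChar V ℂ) {J : ℕ}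
    (hJ : 0 < J)
    (h : 4 * ((A ×ˢ A).filter fun x => ‖ψ (a x.1 - a x.2) - 1‖ < 8 / (J : ℝ)).card ≤ A.card ^ 2) :
    ‖∑ x ∈ A ×ˢ A, ∑ j ∈ Finset.range J, ψ (a x.1 - a x.2) ^ j‖ ≤ (A.card : ℝ) ^ 2 * J / 2 := by
  have hJ' : (0 : ℝ) < J := by exact_mod_cast hJ
  have key : ∀ x ∈ A ×ˢ A, ‖∑ j ∈ Finset.range J, ψ (a x.1 - a x.2) ^ j‖ ≤
      (J : ℝ) / 4 + if ‖ψ (a x.1 - a x.2) - 1‖ < 8 / (J : ℝ) then (J : ℝ) else 0 := by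
    intro x _
    split_ifs with hx
    · refine (norm_sum_le _ _).trans ?_
      simp only [norm_pow, AddChar.norm_apply, one_pow, Finset.sum_const, Finset.card_range,
        nsmul_eq_mul, mul_one]
      linarith
    · rw [add_zero]
      exact norm_geom_sum_le_of_le_norm_sub_one (AddChar.norm_apply _ _) hJ (not_lt.1 hx)
  refine (norm_sum_le _ _).trans ((Finset.sum_le_sum key).trans ?_)
  rw [Finset.sum_add_distrib, ← Finset.sum_filter, Finset.sum_const, Finset.sum_const,
    Finset.card_product, nsmul_eq_mul, nsmul_eq_mul]
  have h' : (4 : ℝ) * (((A ×ˢ A).filter fun x => ‖ψ (a x.1 - a x.2) - 1‖ < 8 / (J : ℝ)).card : ℝ)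
      ≤ (A.card : ℝ) ^ 2 := by exact_mod_cast h
  push_cast
  nlinarith

/-- If the differences `a x - a y` are not concentrated near the kernel of a nontrivial character,
one of them moves a positive proportion `1 / (4 J)` of the set `Y` out of `Y`. -/
lemma exists_card_le_mul_exitCard {ι : Type*} {A : Finset ι} (hA : A.Nonempty) (a : ι → V) {J : ℕ}
    (hJ : 0 < J)
    (h : ∀ ψ : AddChar V ℂ, ψ ≠ 0 →
      4 * ((A ×ˢ A).filter fun x => ‖ψ (a x.1 - a x.2) - 1‖ < 8 / (J : ℝ)).card ≤ A.card ^ 2)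
    {Y : Finset V} (hY : Y.Nonempty) (hYc : 2 * Y.card ≤ Fintype.card V) :
    ∃ x ∈ A, ∃ y ∈ A, Y.card ≤ 4 * J * exitCard Y (a x - a y) := by
  by_contra! hcon
  have hJ' : (0 : ℝ) < J := by exact_mod_cast hJ
  have hA' : (0 : ℝ) < A.card := by exact_mod_cast hA.card_pos
  have hY' : (0 : ℝ) < Y.card := by exact_mod_cast hY.card_pos
  have hYc' : 2 * (Y.card : ℝ) ≤ Fintype.card V := by exact_mod_cast hYc
  have hV' : (0 : ℝ) < Fintype.card V := by linarith
  set P := A ×ˢ A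
  set w : AddChar V ℂ → ℝ := fun ψ => ‖∑ y ∈ Y, ψ y‖ ^ 2
  set g : AddChar V ℂ → ℂ := fun ψ => ∑ x ∈ P, ∑ j ∈ Finset.range J, ψ (a x.1 - a x.2) ^ j
  -- every translate keeps more than three quarters of `Y`
  have hlow : ∀ x ∈ P, ∀ j ∈ Finset.range J,
      3 / 4 * (Y.card : ℝ) < ((Y.filter fun y => y + j • (a x.1 - a x.2) ∈ Y).card : ℝ) := by
    intro x hx j hj
    have h1 := exitCard_nsmul_le Y j (a x.1 - a x.2)
    have h2 := card_filter_add_mem_add_exitCard Y (j • (a x.1 - a x.2))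
    have h3 := hcon x.1 (Finset.mem_product.1 hx).1 x.2 (Finset.mem_product.1 hx).2
    have h4 : j * exitCard Y (a x.1 - a x.2) ≤ J * exitCard Y (a x.1 - a x.2) :=
      Nat.mul_le_mul_right _ (Finset.mem_range.1 hj).le
    have h5 : 3 * Y.card < 4 * (Y.filter fun y => y + j • (a x.1 - a x.2) ∈ Y).card := by
      rw [mul_assoc] at h3
      omega
    have h6 : (3 : ℝ) * Y.card < 4 * ((Y.filter fun y => y + j • (a x.1 - a x.2) ∈ Y).card : ℝ) := by
      exact_mod_cast h5
    linarith
  have htot : ∑ ψ : AddChar V ℂ, (w ψ : ℂ) * g ψ = ((Fintype.card V *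
      ∑ x ∈ P, ∑ j ∈ Finset.range J,
        ((Y.filter fun y => y + j • (a x.1 - a x.2) ∈ Y).card : ℝ) : ℝ) : ℂ) := by
    simp only [g, Finset.mul_sum]
    rw [Finset.sum_comm]
    push_cast
    refine Finset.sum_congr rfl fun x _ => ?_
    rw [Finset.sum_comm]
    refine Finset.sum_congr rfl fun j _ => ?_
    rw [← sum_addChar_norm_sq_mul]
    refine Finset.sum_congr rfl fun ψ _ => ?_
    rw [AddChar.map_nsmul_eq_pow]
  have hw : ∑ ψ : AddChar V ℂ, w ψ = Fintype.card V * Y.card := by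
    have := sum_addChar_norm_sq_mul Y 0
    simp only [AddChar.map_zero_eq_one, mul_one, add_zero] at this
    rw [Finset.filter_true_of_mem (fun _ h => h)] at this
    exact_mod_cast this
  have hw0 : w 0 = (Y.card : ℝ) ^ 2 := by simp [w]
  have hP : (P.card : ℝ) = (A.card : ℝ) ^ 2 := by
    simp only [P, Finset.card_product]
    push_cast
    ring
  have hg0 : ‖g 0‖ = (A.card : ℝ) ^ 2 * J := by
    simp only [g, AddChar.zero_apply, one_pow, Finset.sum_const, Finset.card_range, nsmul_eq_mul,
      mul_one, norm_mul, Complex.norm_natCast, hP]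
  have hup : ‖∑ ψ : AddChar V ℂ, (w ψ : ℂ) * g ψ‖ ≤
      (A.card : ℝ) ^ 2 * J / 2 * (∑ ψ : AddChar V ℂ, w ψ + w 0) := by
    have hterm : ∀ ψ ∈ (Finset.univ : Finset (AddChar V ℂ)), ‖(w ψ : ℂ) * g ψ‖ ≤
        (A.card : ℝ) ^ 2 * J / 2 * (w ψ + if ψ = 0 then w 0 else 0) := by
      intro ψ _
      have hwn : 0 ≤ w ψ := by positivity
      rw [norm_mul, Complex.norm_real, Real.norm_of_nonneg hwn]
      split_ifs with h0
      · subst h0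
        rw [hg0]
        linarith
      · have := norm_sum_geom_sum_le A a ψ hJ (h ψ h0)
        rw [add_zero, mul_comm]
        exact mul_le_mul_of_nonneg_right this hwn
    refine (norm_sum_le _ _).trans ((Finset.sum_le_sum hterm).trans (le_of_eq ?_))
    rw [← Finset.mul_sum, Finset.sum_add_distrib, Finset.sum_ite_eq' Finset.univ (0 : AddChar V ℂ)]
    simp
  have hlow' : (A.card : ℝ) ^ 2 * J * (3 / 4 * (Y.card : ℝ)) < ∑ x ∈ P, ∑ j ∈ Finset.range J,
        ((Y.filter fun y => y + j • (a x.1 - a x.2) ∈ Y).card : ℝ) := by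
    have : (A.card : ℝ) ^ 2 * J * (3 / 4 * (Y.card : ℝ)) =
        ∑ x ∈ P, ∑ j ∈ Finset.range J, (3 / 4 * (Y.card : ℝ)) := by
      simp only [Finset.sum_const, Finset.card_range, nsmul_eq_mul, ← hP]
      ring
    rw [this]
    exact Finset.sum_lt_sum_of_nonempty (hA.product hA) fun x hx =>
      Finset.sum_lt_sum_of_nonempty (Finset.nonempty_range_iff.2 hJ.ne') fun j hj => hlow x hx j hj
  rw [htot, Complex.norm_real, hw, hw0] at hup
  have h1 := (le_abs_self _).trans hup
  have h2 := mul_lt_mul_of_pos_left hlow' hV'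
  have h3 : 0 < (A.card : ℝ) ^ 2 * J := by positivity
  have h4 : (Fintype.card V : ℝ) * Y.card * (3 / 2) < Fintype.card V * Y.card + (Y.card : ℝ) ^ 2 := by
    refine lt_of_mul_lt_mul_left (a := (A.card : ℝ) ^ 2 * J / 2) ?_ (by positivity)
    linarith
  nlinarith

end Fourier

section Concentration

lemma two_mul_min_div_le_sin {i p : ℕ} (hi : i ≤ p) (hp : 0 < p) :
    2 * (min i (p - i) : ℕ) / (p : ℝ) ≤ Real.sin (Real.pi * i / p) := by
  have hp' : (0 : ℝ) < p := by exact_mod_cast hp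
  have hpi := Real.pi_pos
  have key : ∀ k : ℕ, 2 * k ≤ p → 2 * (k : ℝ) / p ≤ Real.sin (Real.pi * k / p) := by
    intro k hk
    have hk' : 2 * (k : ℝ) ≤ p := by exact_mod_cast hk
    refine le_trans (le_of_eq ?_) (Real.mul_le_sin (by positivity) ?_)
    · field_simp
    · rw [div_le_div_iff₀ hp' two_pos]
      nlinarith
  rcases le_total (2 * i) p with h | h
  · rw [min_eq_left (by omega)]
    exact key i h
  · rw [min_eq_right (by omega)]
    refine (key (p - i) (by omega)).trans (le_of_eq ?_)
    rw [← Real.sin_pi_sub]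
    congr 1
    rw [Nat.cast_sub hi]
    field_simp
    ring

lemma exists_finset_of_pow_eq_one_of_norm_sub_one_lt {p W : ℕ} (hW : 0 < W) (hWp : W ≤ p) :
    ∃ R : Finset ℂ, R.card ≤ 8 * W ∧
      ∀ z : ℂ, z ^ p = 1 → ‖z - 1‖ < 8 / ((p / W : ℕ) : ℝ) → z ∈ R := by
  have hp : 0 < p := hW.trans_le hWp
  have : NeZero p := ⟨hp.ne'⟩
  have hp' : (0 : ℝ) < p := by exact_mod_cast hp
  set ζ : ℂ := Complex.exp (2 * Real.pi * Complex.I / p)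
  refine ⟨(Finset.range (4 * W) ∪ (Finset.range (4 * W)).image (fun i => p - i)).image
    (fun i => ζ ^ i), ?_, ?_⟩
  · refine Finset.card_image_le.trans ((Finset.card_union_le _ _).trans ?_)
    have := Finset.card_image_le (s := Finset.range (4 * W)) (f := fun i => p - i)
    simp only [Finset.card_range] at this ⊢
    omega
  · intro z hz hlt
    obtain ⟨i, hi, rfl⟩ := (Complex.isPrimitiveRoot_exp p hp.ne').eq_pow_of_pow_eq_one hz
    refine Finset.mem_image_of_mem _ ?_
    by_contra hmem
    simp only [Finset.mem_union, Finset.mem_range, Finset.mem_image, not_or, not_lt, not_exists,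
      not_and] at hmem
    have h1 : 4 * W ≤ p - i := by
      by_contra! hcon
      exact hmem.2 (p - i) hcon (by omega)
    have h2 : 4 * W ≤ min i (p - i) := le_min hmem.1 h1
    have hnorm : ‖Complex.exp (2 * Real.pi * Complex.I / p) ^ i - 1‖ =
        2 * |Real.sin (Real.pi * i / p)| := by
      rw [← Complex.exp_nat_mul]
      have : (i : ℂ) * (2 * Real.pi * Complex.I / p) =
          Complex.I * ((2 * (Real.pi * i / p) : ℝ) : ℂ) := by
        push_cast
        ring
      rw [this, Complex.norm_exp_I_mul_ofReal_sub_one, Real.norm_eq_abs, abs_mul, abs_two,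
        mul_div_cancel_left₀ _ (two_ne_zero)]
    rw [hnorm] at hlt
    have h3 := (two_mul_min_div_le_sin hi.le hp).trans (le_abs_self _)
    have hJ : 1 ≤ p / W := (Nat.one_le_div_iff hW).2 hWp
    have hJ' : (0 : ℝ) < ((p / W : ℕ) : ℝ) := by exact_mod_cast hJ
    have h4 : p ≤ 2 * W * (p / W) := by
      have := Nat.lt_mul_div_succ p hW
      nlinarith
    have h4' : (p : ℝ) ≤ 2 * W * ((p / W : ℕ) : ℝ) := by exact_mod_cast h4
    have h2' : 4 * (W : ℝ) ≤ ((min i (p - i) : ℕ) : ℝ) := by exact_mod_cast h2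
    have h5 : 2 * (4 * (W : ℝ)) / p < 4 / ((p / W : ℕ) : ℝ) := by
      calc 2 * (4 * (W : ℝ)) / p ≤ 2 * ((min i (p - i) : ℕ) : ℝ) / p := by gcongr
        _ ≤ |Real.sin (Real.pi * i / p)| := h3
        _ < 4 / ((p / W : ℕ) : ℝ) := by
          have : (8 : ℝ) / ((p / W : ℕ) : ℝ) = 2 * (4 / ((p / W : ℕ) : ℝ)) := by ring
          linarith
    rw [div_lt_div_iff₀ hp' hJ'] at h5
    linarith

variable {V : Type*} [AddCommGroup V]

lemma card_close_pairs_le {p W : ℕ} (hW : 0 < W) (hWp : W ≤ p) (hV : ∀ v : V, p • v = 0)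
    {ι : Type*} (A : Finset ι) (a : ι → V) (ψ : AddChar V ℂ)
    (h : ∀ z : ℂ, 32 * W * (A.filter fun x => ψ (a x) = z).card ≤ A.card) :
    4 * ((A ×ˢ A).filter fun x =>
      ‖ψ (a x.1 - a x.2) - 1‖ < 8 / ((p / W : ℕ) : ℝ)).card ≤ A.card ^ 2 := by
  obtain ⟨R, hR, hmem⟩ := exists_finset_of_pow_eq_one_of_norm_sub_one_lt hW hWp
  have hsub : ((A ×ˢ A).filter fun x => ‖ψ (a x.1 - a x.2) - 1‖ < 8 / ((p / W : ℕ) : ℝ)) ⊆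
      (A ×ˢ R).biUnion fun q => (A.filter fun x => ψ (a x) = q.2 * ψ (a q.1)).image
        (fun x => (x, q.1)) := by
    rintro ⟨x, y⟩ hxy
    simp only [Finset.mem_filter, Finset.mem_product] at hxy
    simp only [Finset.mem_biUnion, Finset.mem_product, Finset.mem_image, Finset.mem_filter,
      Prod.exists]
    refine ⟨y, ψ (a x - a y), ⟨hxy.1.2, hmem _ ?_ hxy.2⟩, x, ⟨hxy.1.1, ?_⟩, rfl⟩
    · rw [← AddChar.map_nsmul_eq_pow, hV, AddChar.map_zero_eq_one]
    · rw [← AddChar.map_add_eq_mul, sub_add_cancel]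
  have hcard := (Finset.card_le_card hsub).trans Finset.card_biUnion_le
  have hle : 32 * W * ((A ×ˢ A).filter fun x =>
      ‖ψ (a x.1 - a x.2) - 1‖ < 8 / ((p / W : ℕ) : ℝ)).card ≤ (A.card * (8 * W)) * A.card := by
    calc _ ≤ 32 * W * ∑ q ∈ A ×ˢ R, ((A.filter fun x => ψ (a x) = q.2 * ψ (a q.1)).image
          (fun x => (x, q.1))).card := Nat.mul_le_mul_left _ hcard
      _ = ∑ q ∈ A ×ˢ R, 32 * W * ((A.filter fun x => ψ (a x) = q.2 * ψ (a q.1)).image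
          (fun x => (x, q.1))).card := Finset.mul_sum _ _ _
      _ ≤ ∑ q ∈ A ×ˢ R, A.card := Finset.sum_le_sum fun q _ =>
          (Nat.mul_le_mul_left _ Finset.card_image_le).trans (h _)
      _ = (A.card * R.card) * A.card := by
          rw [Finset.sum_const, Finset.card_product, smul_eq_mul]
      _ ≤ _ := by gcongr
  refine Nat.le_of_mul_le_mul_left (c := 8 * W) ?_ (by omega)
  nlinarith

end Concentration

section Growth

variable {V : Type*} [AddCommGroup V] [Fintype V] {ι : Type*}

lemma exists_large_set_of_sums {A : Finset ι} {a : ι → V} {J M : ℕ} (hJ : 0 < J)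
    (hM : M < A.card)
    (hgrow : ∀ U : Finset ι, U.card ≤ M → ∀ Y : Finset V, Y.Nonempty →
      2 * Y.card ≤ Fintype.card V →
      ∃ x ∈ A \ U, ∃ y ∈ A \ U, Y.card ≤ 4 * J * exitCard Y (a x - a y))
    (U₀ : Finset ι) (s : ℕ) (hs : U₀.card + 2 * s ≤ M) :
    ∃ U ⊆ A \ U₀, U.card ≤ 2 * s ∧ ∃ Y : Finset V, Y.Nonempty ∧
      (∀ y ∈ Y, ∃ I ⊆ U, I.card = s ∧ ∑ i ∈ I, a i = y) ∧
      (Fintype.card V < 2 * Y.card ∨ (1 + 1 / (4 * J : ℝ)) ^ s ≤ Y.card) := by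
  have hJ' : (0 : ℝ) < J := by exact_mod_cast hJ
  induction s with
  | zero =>
    refine ⟨∅, Finset.empty_subset _, by simp, {0}, Finset.singleton_nonempty 0, ?_, ?_⟩
    · intro y hy
      rw [Finset.mem_singleton] at hy
      exact ⟨∅, Finset.Subset.refl _, rfl, by simp [hy]⟩
    · right
      simp
  | succ s ih =>
    obtain ⟨U, hUA, hUc, Y, hY, hsum, hlarge⟩ := ih (by omega)
    have hUU : (U₀ ∪ U).card ≤ U₀.card + 2 * s :=
      (Finset.card_union_le _ _).trans (Nat.add_le_add_left hUc _)
    have hins : ∀ x ∈ A \ (U₀ ∪ U), ∀ U' : Finset ι, insert x U ⊆ U' → ∀ y ∈ Y,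
        ∃ I ⊆ U', I.card = s + 1 ∧ ∑ i ∈ I, a i = y + a x := by
      intro x hx U' hU' y hy
      obtain ⟨I, hIU, hIc, hIs⟩ := hsum y hy
      have hxI : x ∉ I := fun hxI =>
        (Finset.mem_sdiff.1 hx).2 (Finset.mem_union_right _ (hIU hxI))
      refine ⟨insert x I, (Finset.insert_subset_insert x hIU).trans hU', ?_, ?_⟩
      · rw [Finset.card_insert_of_notMem hxI, hIc]
      · rw [Finset.sum_insert hxI, hIs, add_comm]
    have hmem : ∀ x ∈ A \ (U₀ ∪ U), x ∈ A \ U₀ := fun x hx =>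
      Finset.sdiff_subset_sdiff (Finset.Subset.refl _) Finset.subset_union_left hx
    by_cases hbig : Fintype.card V < 2 * Y.card
    · obtain ⟨x, hx⟩ : (A \ (U₀ ∪ U)).Nonempty := by
        rw [← Finset.card_pos]
        have := Finset.le_card_sdiff (U₀ ∪ U) A
        omega
      refine ⟨insert x U, Finset.insert_subset (hmem x hx) hUA, ?_,
        Y.image (fun y => y + a x), hY.image _, ?_, Or.inl ?_⟩
      · have := Finset.card_insert_le x U
        omega
      · intro y' hy'
        obtain ⟨y, hy, rfl⟩ := Finset.mem_image.1 hy'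
        exact hins x hx _ (Finset.Subset.refl _) y hy
      · rwa [Finset.card_image_of_injective _ (add_left_injective (a x))]
    · have hpow := hlarge.resolve_left hbig
      obtain ⟨x, hx, y, hy, hexit⟩ := hgrow (U₀ ∪ U) (by omega) Y hY (not_lt.1 hbig)
      refine ⟨insert x (insert y U), Finset.insert_subset (hmem x hx)
        (Finset.insert_subset (hmem y hy) hUA), ?_,
        Y.image (fun v => v + a y) ∪ Y.image (fun v => v + a x),
        (hY.image _).mono Finset.subset_union_left, ?_, Or.inr ?_⟩
      · have h1 := Finset.card_insert_le x (insert y U)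
        have h2 := Finset.card_insert_le y U
        omega
      · intro v hv
        rcases Finset.mem_union.1 hv with hv | hv
        · obtain ⟨w, hw, rfl⟩ := Finset.mem_image.1 hv
          exact hins y hy _ (Finset.subset_insert _ _) w hw
        · obtain ⟨w, hw, rfl⟩ := Finset.mem_image.1 hv
          exact hins x hx _ (Finset.insert_subset_insert _ (Finset.subset_insert _ _)) w hw
      · have h1 : (Y.card : ℝ) + exitCard Y (a x - a y) ≤
            ((Y.image (fun v => v + a y) ∪ Y.image (fun v => v + a x)).card : ℝ) := by
          exact_mod_cast card_add_exitCard_le_card_union Y (a y) (a x)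
        have h2 : (Y.card : ℝ) ≤ 4 * J * exitCard Y (a x - a y) := by exact_mod_cast hexit
        refine le_trans ?_ h1
        rw [pow_succ]
        calc (1 + 1 / (4 * J : ℝ)) ^ s * (1 + 1 / (4 * J : ℝ))
            ≤ Y.card * (1 + 1 / (4 * J : ℝ)) := by gcongr
          _ = Y.card + Y.card / (4 * J) := by ring
          _ ≤ Y.card + exitCard Y (a x - a y) := by
            gcongr
            rw [div_le_iff₀ (by positivity)]
            linarith

lemma two_pow_le_one_add_inv_pow {J : ℕ} (hJ : 0 < J) (m : ℕ) :
    (2 : ℝ) ^ m ≤ (1 + 1 / (4 * J : ℝ)) ^ (4 * J * m) := by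
  have hJ' : (0 : ℝ) < J := by exact_mod_cast hJ
  rw [pow_mul]
  gcongr
  have h0 : (0 : ℝ) ≤ 1 / (4 * J) := by positivity
  have := one_add_mul_le_pow (a := 1 / (4 * J : ℝ)) (by linarith) (4 * J)
  refine le_trans (le_of_eq ?_) this
  push_cast
  field_simp
  norm_num

lemma exists_zero_sum_of_growth {A : Finset ι} {a : ι → V} {J p m : ℕ} (hJ : 0 < J)
    (hm : Fintype.card V ≤ 2 ^ m) (hp : 8 * J * m ≤ p) (hA : 3 * p ≤ A.card) (hp0 : 0 < p)
    (hgrow : ∀ U : Finset ι, U.card ≤ 2 * p → ∀ Y : Finset V, Y.Nonempty →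
      2 * Y.card ≤ Fintype.card V →
      ∃ x ∈ A \ U, ∃ y ∈ A \ U, Y.card ≤ 4 * J * exitCard Y (a x - a y)) :
    ∃ I ⊆ A, I.card = p ∧ ∑ i ∈ I, a i = 0 := by
  set s := 4 * J * m with hs
  have h2s : 2 * s ≤ p := by
    rw [hs]
    linarith
  have hbig : ∀ Y : Finset V, (Fintype.card V < 2 * Y.card ∨
      (1 + 1 / (4 * J : ℝ)) ^ s ≤ Y.card) → Fintype.card V < 2 * Y.card := by
    rintro Y (h | h)
    · exact h
    · have h1 := (two_pow_le_one_add_inv_pow hJ m).trans h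
      have h2 : 2 ^ m ≤ Y.card := by exact_mod_cast h1
      have h3 : 0 < Fintype.card V := Fintype.card_pos
      omega
  obtain ⟨U₁, hU₁A, hU₁c, Y₁, -, hsum₁, hY₁⟩ :=
    exists_large_set_of_sums hJ (by omega) hgrow ∅ s (by simp; omega)
  obtain ⟨U₂, hU₂A, hU₂c, Y₂, -, hsum₂, hY₂⟩ :=
    exists_large_set_of_sums hJ (by omega) hgrow U₁ s (by omega)
  rw [Finset.sdiff_empty] at hU₁A
  have hcard : p - 2 * s ≤ (A \ (U₁ ∪ U₂)).card := by
    have h1 := Finset.le_card_sdiff (U₁ ∪ U₂) A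
    have h2 := Finset.card_union_le U₁ U₂
    omega
  obtain ⟨R, hRA, hRc⟩ := Finset.exists_subset_card_eq hcard
  have hlt := add_lt_add (hbig Y₁ hY₁) (hbig Y₂ hY₂)
  have himage : (Y₂.image fun y => -(∑ i ∈ R, a i) - y).card = Y₂.card :=
    Finset.card_image_of_injective _ sub_right_injective
  have hinter : (Y₁ ∩ Y₂.image fun y => -(∑ i ∈ R, a i) - y).Nonempty := by
    rw [← Finset.card_pos]
    have h1 := Finset.card_union_add_card_inter Y₁ (Y₂.image fun y => -(∑ i ∈ R, a i) - y)
    have h2 := Finset.card_le_univ (Y₁ ∪ Y₂.image fun y => -(∑ i ∈ R, a i) - y)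
    omega
  obtain ⟨y₁, hy₁⟩ := hinter
  obtain ⟨hy₁, hy₁'⟩ := Finset.mem_inter.1 hy₁
  obtain ⟨y₂, hy₂, hy⟩ := Finset.mem_image.1 hy₁'
  obtain ⟨I₁, hI₁, hI₁c, hI₁s⟩ := hsum₁ y₁ hy₁
  obtain ⟨I₂, hI₂, hI₂c, hI₂s⟩ := hsum₂ y₂ hy₂
  have hd₁₂ : Disjoint I₁ I₂ := Finset.disjoint_left.2 fun x hx hx' =>
    (Finset.mem_sdiff.1 (hU₂A (hI₂ hx'))).2 (hI₁ hx)
  have hdR : Disjoint (I₁ ∪ I₂) R := Finset.disjoint_left.2 fun x hx hx' =>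
    (Finset.mem_sdiff.1 (hRA hx')).2 (Finset.union_subset_union hI₁ hI₂ hx)
  refine ⟨I₁ ∪ I₂ ∪ R, Finset.union_subset (Finset.union_subset (hI₁.trans hU₁A)
    (hI₂.trans (hU₂A.trans Finset.sdiff_subset))) (hRA.trans Finset.sdiff_subset), ?_, ?_⟩
  · rw [Finset.card_union_of_disjoint hdR, Finset.card_union_of_disjoint hd₁₂]
    omega
  · rw [Finset.sum_union hdR, Finset.sum_union hd₁₂, hI₁s, hI₂s, ← hy]
    abel

end Growth

lemma exists_zero_sum_card_eq {p W m : ℕ} (hp : p.Prime) (hm : 1 ≤ m) (hmW : 8 * m ≤ W)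
    (hWp : W ≤ p) {ι : Type*} (r : ℕ) :
    ∀ (V : Type) [AddCommGroup V] [Finite V] (_ : ∀ v : V, p • v = 0) (_ : Nat.card V ∣ p ^ r)
      (_ : Nat.card V ≤ 2 ^ m) (A : Finset ι) (a : ι → V) (_ : 4 * p * (64 * W) ^ r ≤ A.card),
      ∃ I ⊆ A, I.card = p ∧ ∑ i ∈ I, a i = 0 := by
  have hW : 0 < W := by omega
  have hp0 := hp.pos
  induction r with
  | zero =>
    intro V _ _ hV hcard _ A a hA
    have : Subsingleton V := by
      rw [pow_zero, Nat.dvd_one] at hcard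
      exact (Nat.card_eq_one_iff_unique.1 hcard).1
    obtain ⟨I, hI, hIc⟩ := Finset.exists_subset_card_eq (s := A) (n := p)
      (by rw [pow_zero, mul_one] at hA; omega)
    exact ⟨I, hI, hIc, Subsingleton.elim _ _⟩
  | succ r ih =>
    intro V _ _ hV hcard hVm A a hA
    have := Fintype.ofFinite V
    by_cases hconc : ∃ ψ : AddChar V ℂ, ψ ≠ 0 ∧ ∃ z : ℂ,
        A.card ≤ 64 * W * (A.filter fun x => ψ (a x) = z).card
    · obtain ⟨ψ, hψ, z, hz⟩ := hconc
      set B := A.filter fun x => ψ (a x) = z with hB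
      have hBc : 4 * p * (64 * W) ^ r ≤ B.card := by
        refine Nat.le_of_mul_le_mul_left (c := 64 * W) ?_ (by omega)
        calc _ = 4 * p * (64 * W) ^ (r + 1) := by ring
          _ ≤ _ := hA.trans hz
      obtain ⟨x₀, hx₀⟩ : B.Nonempty := by
        rw [← Finset.card_pos]
        exact lt_of_lt_of_le (by positivity) hBc
      set H : AddSubgroup V := (AddChar.toAddMonoidHom ψ).ker
      have hmemH : ∀ v : V, v ∈ H ↔ ψ v = 1 := fun v => Iff.rfl
      have hHne : Nat.card H ≠ Nat.card V := by
        intro h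
        apply hψ
        have := AddSubgroup.eq_top_of_card_eq H h
        ext v
        have hv : v ∈ H := by
          rw [this]
          exact AddSubgroup.mem_top v
        simpa using (hmemH v).1 hv
      have hHV : Nat.card H ∣ Nat.card V := AddSubgroup.card_addSubgroup_dvd_card H
      have hHcard : Nat.card H ∣ p ^ r := by
        obtain ⟨k, hk, hVk⟩ := (Nat.dvd_prime_pow hp).1 hcard
        rw [hVk] at hHV hHne
        obtain ⟨l, hl, hHl⟩ := (Nat.dvd_prime_pow hp).1 hHV
        have hlk : l ≠ k := by
          rintro rfl
          exact hHne hHl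
        rw [hHl]
        exact pow_dvd_pow p (by omega)
      have hdiff : ∀ x ∈ B, a x - a x₀ ∈ H := by
        intro x hx
        rw [hmemH, sub_eq_add_neg, AddChar.map_add_eq_mul, (Finset.mem_filter.1 hx).2,
          ← (Finset.mem_filter.1 hx₀).2, ← AddChar.map_add_eq_mul, add_neg_cancel,
          AddChar.map_zero_eq_one]
      obtain ⟨I, hIB, hIc, hIs⟩ := ih H (fun v => Subtype.ext (hV v)) hHcard
        ((Nat.le_of_dvd Nat.card_pos hHV).trans hVm) B
        (fun x => if h : x ∈ B then ⟨a x - a x₀, hdiff x h⟩ else 0) hBc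
      refine ⟨I, hIB.trans (Finset.filter_subset _ _), hIc, ?_⟩
      have hsum := congrArg (fun v : H => (v : V)) hIs
      simp only [AddSubgroup.val_finsetSum, ZeroMemClass.coe_zero] at hsum
      have hsum' : ∑ x ∈ I, (a x - a x₀) = 0 := by
        rw [← hsum]
        refine Finset.sum_congr rfl fun x hx => ?_
        rw [dif_pos (hIB hx)]
      rwa [Finset.sum_sub_distrib, Finset.sum_const, hIc, hV, sub_zero] at hsum'
    · push Not at hconc
      have hJ : 0 < p / W := Nat.div_pos hWp hW
      have hA4 : 4 * p ≤ A.card := (Nat.le_mul_of_pos_right _ (by positivity)).trans hA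
      refine exists_zero_sum_of_growth (J := p / W) (m := m) hJ
        (by rwa [← Nat.card_eq_fintype_card]) ?_ (by omega) hp0 ?_
      · calc 8 * (p / W) * m = (p / W) * (8 * m) := by ring
          _ ≤ (p / W) * W := Nat.mul_le_mul_left _ hmW
          _ ≤ p := Nat.div_mul_le_self p W
      · intro U hU Y hY hYc
        have hAU : A.card ≤ 2 * (A \ U).card := by
          have := Finset.le_card_sdiff U A
          omega
        refine exists_card_le_mul_exitCard (by rw [← Finset.card_pos]; omega) a hJ ?_ hY hYc
        intro ψ hψ
        refine card_close_pairs_le hW hWp hV _ a ψ fun z => ?_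
        have h1 := hconc ψ hψ z
        have h2 : ((A \ U).filter fun x => ψ (a x) = z).card ≤
            (A.filter fun x => ψ (a x) = z).card :=
          Finset.card_le_card (Finset.filter_subset_filter _ Finset.sdiff_subset)
        have h3 := Nat.mul_le_mul_left (64 * W) h2
        have h4 : 64 * W * ((A \ U).filter fun x => ψ (a x) = z).card =
          2 * (32 * W * ((A \ U).filter fun x => ψ (a x) = z).card) := by ring
        omega

lemma eventually_exists_width (r : ℕ) (hr : 1 ≤ r) {δ : ℝ} (hδ : 0 < δ) :
    ∃ N : ℕ, ∀ p : ℕ, N ≤ p → ∃ W m : ℕ, 1 ≤ m ∧ 8 * m ≤ W ∧ W ≤ p ∧ p ^ r ≤ 2 ^ m ∧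
      ((4 * p * (64 * W) ^ r : ℕ) : ℝ) ≤ δ * (p : ℝ) ^ 2 := by
  set C : ℝ := 4 * (64 * (24 * r)) ^ r with hC
  have hr' : (0 : ℝ) < r := by exact_mod_cast hr
  have hCpos : 0 < C := by positivity
  have hcast := tendsto_natCast_atTop_atTop (R := ℝ)
  have h1 : ∀ᶠ p : ℕ in Filter.atTop, ‖Real.log p ^ r‖ ≤ δ / C * ‖(p : ℝ)‖ :=
    hcast.eventually ((Real.isLittleO_pow_log_id_atTop (n := r)).def (by positivity))
  have h2 : ∀ᶠ p : ℕ in Filter.atTop, ‖Real.log p ^ 1‖ ≤ 1 / (24 * r) * ‖(p : ℝ)‖ :=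
    hcast.eventually ((Real.isLittleO_pow_log_id_atTop (n := 1)).def (by positivity))
  obtain ⟨N, hN⟩ := Filter.eventually_atTop.1 ((h1.and h2).and (Filter.eventually_ge_atTop 3))
  refine ⟨N, fun p hp => ?_⟩
  obtain ⟨⟨h1, h2⟩, h3⟩ := hN p hp
  have h3' : (3 : ℝ) ≤ p := by exact_mod_cast h3
  have hlog1 : 1 ≤ Real.log p := by
    rw [Real.le_log_iff_exp_le (by linarith)]
    linarith [Real.exp_one_lt_d9]
  have hlog : ((Nat.log 2 p + 1 : ℕ) : ℝ) ≤ 3 * Real.log p := by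
    have h4 : (2 : ℝ) ^ Nat.log 2 p ≤ p := by
      exact_mod_cast Nat.pow_log_le_self 2 (by omega)
    have h5 := Real.log_le_log (by positivity) h4
    rw [Real.log_pow] at h5
    have h6 := Real.log_two_gt_d9
    have h7 : (0 : ℝ) ≤ Nat.log 2 p := by positivity
    push_cast
    nlinarith
  rw [Real.norm_of_nonneg (by positivity), Real.norm_of_nonneg (by positivity)] at h1 h2
  rw [pow_one] at h2
  have hW : ((8 * (r * (Nat.log 2 p + 1)) : ℕ) : ℝ) ≤ 24 * r * Real.log p := by
    push_cast at hlog ⊢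
    nlinarith
  refine ⟨8 * (r * (Nat.log 2 p + 1)), r * (Nat.log 2 p + 1), ?_, le_rfl, ?_, ?_, ?_⟩
  · exact Nat.mul_pos hr (Nat.succ_pos _)
  · have : 24 * r * Real.log p ≤ p := by
      rw [div_mul_eq_mul_div, one_mul, le_div_iff₀ (by positivity)] at h2
      linarith
    exact_mod_cast hW.trans this
  · rw [mul_comm, pow_mul]
    exact Nat.pow_le_pow_left (Nat.lt_pow_succ_log_self (by norm_num) p).le r
  · rw [Nat.cast_mul, Nat.cast_pow, Nat.cast_mul 64]
    calc ((4 * p : ℕ) : ℝ) * (((64 : ℕ) : ℝ) * ((8 * (r * (Nat.log 2 p + 1)) : ℕ) : ℝ)) ^ r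
        ≤ ((4 * p : ℕ) : ℝ) * (((64 : ℕ) : ℝ) * (24 * r * Real.log p)) ^ r := by gcongr
      _ = p * (C * Real.log p ^ r) := by
        rw [hC]
        push_cast
        rw [show (64 : ℝ) * (24 * r * Real.log p) = 64 * (24 * r) * Real.log p by ring, mul_pow]
        ring
      _ ≤ p * (C * (δ / C * p)) := by gcongr
      _ = δ * (p : ℝ) ^ 2 := by
        field_simp

section Multiset

lemma exists_fin_map_eq {G : Type*} (S : Multiset G) :
    ∃ a : Fin (Multiset.card S) → G, Finset.univ.val.map a = S := by
  induction S using Quotient.inductionOn with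
  | h L =>
    refine ⟨L.get, ?_⟩
    change Finset.univ.val.map L.get = (L : Multiset G)
    rw [Fin.univ_val_map, List.ofFn_get]

/-- Asymptotic form of a theorem of Alon and Dubiner: for large primes `p`, a sequence of length
`δ p ^ 2` over an elementary `p`-group of bounded rank has a zero-sum subsequence of length `p`. -/
lemma exists_forall_prime_exists_zero_sum_card_eq (r : ℕ) (hr : 1 ≤ r) {δ : ℝ} (hδ : 0 < δ) :
    ∃ N : ℕ, ∀ p : ℕ, p.Prime → N ≤ p → ∀ (G V : Type) [AddCommGroup G] [AddCommGroup V]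
      [Finite V] (f : G →+ V) (_ : ∀ v : V, p • v = 0) (_ : Nat.card V ∣ p ^ r) (S : Multiset G)
      (_ : δ * (p : ℝ) ^ 2 ≤ Multiset.card S),
      ∃ T ≤ S, Multiset.card T = p ∧ f T.sum = 0 := by
  obtain ⟨N, hN⟩ := eventually_exists_width r hr hδ
  refine ⟨N, fun p hp hpN G V _ _ _ f hV hcard S hS => ?_⟩
  obtain ⟨W, m, hm, hmW, hWp, hpm, hbound⟩ := hN p hpN
  obtain ⟨a, ha⟩ := exists_fin_map_eq S
  obtain ⟨I, -, hIc, hIs⟩ := exists_zero_sum_card_eq hp hm hmW hWp r V hV hcard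
    ((Nat.le_of_dvd (pow_pos hp.pos r) hcard).trans hpm) Finset.univ (fun i => f (a i))
    (by rw [Finset.card_univ, Fintype.card_fin]; exact_mod_cast hbound.trans hS)
  refine ⟨I.val.map a, ?_, by simpa using hIc, ?_⟩
  · conv_rhs => rw [← ha]
    exact Multiset.map_le_map (Finset.val_le_iff.2 (Finset.subset_univ I))
  · rw [← map_sum] at hIs
    exact hIs

/-- The upper bound for the Davenport constant of an elementary `p`-group of rank at most `r`. -/
lemma exists_zero_sum_of_prime {p r : ℕ} (hp : p.Prime) {G : Type*} [AddCommGroup G]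
    (f : (Fin r → ℤ) →+ G) (hf : Function.Surjective f) (hG : ∀ g : G, p • g = 0)
    (S : Multiset G) (hS : r * (p - 1) < Multiset.card S) : ∃ T ≤ S, T ≠ 0 ∧ T.sum = 0 := by
  have : Fact p.Prime := ⟨hp⟩
  obtain ⟨a, ha⟩ := exists_fin_map_eq S
  choose b hb using fun i => hf (a i)
  set F : Fin r → MvPolynomial (Fin (Multiset.card S)) (ZMod p) := fun j =>
    ∑ i, MvPolynomial.C ((b i j : ℤ) : ZMod p) * MvPolynomial.X i ^ (p - 1) with hF
  have hdeg : ∑ j, (F j).totalDegree < Fintype.card (Fin (Multiset.card S)) := by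
    rw [Fintype.card_fin]
    refine lt_of_le_of_lt (Finset.sum_le_sum (g := fun _ => p - 1) fun j _ => ?_) ?_
    · refine (MvPolynomial.totalDegree_finsetSum _ _).trans (Finset.sup_le fun i _ => ?_)
      refine (MvPolynomial.totalDegree_mul _ _).trans ?_
      rw [MvPolynomial.totalDegree_C, zero_add, MvPolynomial.totalDegree_X_pow]
    · simpa using hS
  have heval : ∀ x j, MvPolynomial.eval x (F j) =
      ∑ i, ((b i j : ℤ) : ZMod p) * x i ^ (p - 1) := by
    intro x j
    simp [hF]
  have hdvd : p ∣ Nat.card {x : Fin (Multiset.card S) → ZMod p //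
      ∀ j, MvPolynomial.eval x (F j) = 0} := by
    rw [Nat.card_eq_fintype_card]
    convert char_dvd_card_solutions_of_fintype_sum_lt p hdeg
  have hzero : ∀ j, MvPolynomial.eval (0 : Fin (Multiset.card S) → ZMod p) (F j) = 0 := by
    intro j
    rw [heval]
    refine Finset.sum_eq_zero fun i _ => ?_
    rw [Pi.zero_apply, zero_pow (by have := hp.two_le; omega), mul_zero]
  have : Nonempty {x : Fin (Multiset.card S) → ZMod p //
      ∀ j, MvPolynomial.eval x (F j) = 0} := ⟨⟨0, hzero⟩⟩
  have : Nontrivial {x : Fin (Multiset.card S) → ZMod p //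
      ∀ j, MvPolynomial.eval x (F j) = 0} :=
    Finite.one_lt_card_iff_nontrivial.1
      (lt_of_lt_of_le hp.one_lt (Nat.le_of_dvd Nat.card_pos hdvd))
  obtain ⟨⟨x, hx⟩, hx0⟩ := exists_ne (⟨0, hzero⟩ : {x : Fin (Multiset.card S) → ZMod p //
      ∀ j, MvPolynomial.eval x (F j) = 0})
  have hx0' : x ≠ 0 := fun h => hx0 (Subtype.ext h)
  obtain ⟨i₀, hi₀⟩ := Function.ne_iff.1 hx0'
  set I := Finset.univ.filter fun i => x i ≠ 0 with hI
  have hsum : ∀ j, (p : ℤ) ∣ ∑ i ∈ I, b i j := by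
    intro j
    rw [← ZMod.intCast_zmod_eq_zero_iff_dvd, Int.cast_sum]
    have h := hx j
    rw [heval] at h
    rw [hI, Finset.sum_filter]
    refine Eq.trans ?_ h
    refine Finset.sum_congr rfl fun i _ => ?_
    split_ifs with hxi
    · rw [ZMod.pow_card_sub_one_eq_one hxi, mul_one]
    · rw [not_not.1 hxi, zero_pow (by have := hp.two_le; omega), mul_zero]
  choose c hc using hsum
  refine ⟨I.val.map a, ?_, ?_, ?_⟩
  · conv_rhs => rw [← ha]
    exact Multiset.map_le_map (Finset.val_le_iff.2 (Finset.subset_univ I))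
  · rw [Ne, Multiset.map_eq_zero, Finset.val_eq_zero]
    exact Finset.ne_empty_of_mem (Finset.mem_filter.2 ⟨Finset.mem_univ i₀, hi₀⟩)
  · change ∑ i ∈ I, a i = 0
    have h1 : ∑ i ∈ I, b i = p • c := by
      ext j
      rw [Finset.sum_apply, hc j]
      simp
    rw [← hG (f c), ← map_nsmul, ← h1, map_sum]
    exact Finset.sum_congr rfl fun i _ => (hb i).symm

/-- Repeated extraction of disjoint short subsequences with sum in the subgroup `H`. -/
lemma exists_multiset_subgroup {G : Type*} [AddCommGroup G] (H : AddSubgroup G) {p : ℕ}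
    (hp : 0 < p) {η : ℝ}
    (hη : ∀ S : Multiset G, η ≤ Multiset.card S → ∃ T ≤ S, Multiset.card T = p ∧ T.sum ∈ H)
    (t : ℕ) : ∀ S : Multiset G, (p : ℝ) * (t - 1) + η ≤ Multiset.card S →
      ∃ U : Multiset H, Multiset.card U = t ∧
        ∀ U' ≤ U, ∃ T ≤ S, T.sum = (U'.sum : G) ∧ (T = 0 → U' = 0) := by
  induction t with
  | zero =>
    intro S _
    refine ⟨0, rfl, fun U' hU' => ⟨0, Multiset.zero_le _, ?_, fun _ => Multiset.le_zero.1 hU'⟩⟩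
    rw [Multiset.le_zero.1 hU']
    simp
  | succ t ih =>
    intro S hS
    have ht : (0 : ℝ) ≤ p * t := by positivity
    push_cast at hS
    obtain ⟨T₁, hT₁, hT₁c, hT₁H⟩ := hη S (by linarith)
    obtain ⟨S', rfl⟩ := Multiset.le_iff_exists_add.1 hT₁
    rw [Multiset.card_add, hT₁c] at hS
    push_cast at hS
    obtain ⟨U, hUc, hU⟩ := ih S' (by linarith)
    refine ⟨⟨T₁.sum, hT₁H⟩ ::ₘ U, by simp [hUc], fun U' hU' => ?_⟩
    by_cases hmem : (⟨T₁.sum, hT₁H⟩ : H) ∈ U'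
    · obtain ⟨U'', rfl⟩ := Multiset.exists_cons_of_mem hmem
      obtain ⟨T, hT, hTs, -⟩ := hU U'' ((Multiset.cons_le_cons_iff _).1 hU')
      refine ⟨T₁ + T, Multiset.add_le_add_iff_left.2 hT, ?_, fun h => ?_⟩
      · rw [Multiset.sum_add, hTs, Multiset.sum_cons]
        rfl
      · have : T₁ = 0 := (add_eq_zero.1 h).1
        rw [this, Multiset.card_zero] at hT₁c
        omega
    · obtain ⟨T, hT, hTs, hT0⟩ := hU U' ((Multiset.le_cons_of_notMem hmem).1 hU')
      exact ⟨T, hT.trans (Multiset.le_add_left _ _), hTs, hT0⟩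

end Multiset

/-- A group generated by `r` elements whose exponent divides `n` has Davenport constant at most
`(r + 2 δ) n` if all prime factors of `n` are large enough. -/
lemma exists_forall_exists_zero_sum (r : ℕ) (hr : 1 ≤ r) {δ : ℝ} (hδ : 0 < δ) :
    ∃ N : ℕ, ∀ n : ℕ, 1 < n → N ≤ n.minFac → ∀ (G : Type) [AddCommGroup G]
      (f : (Fin r → ℤ) →+ G) (_ : Function.Surjective f) (_ : ∀ g : G, n • g = 0)
      (S : Multiset G) (_ : r * (n : ℝ) + 2 * δ * (n - n.minFac) ≤ Multiset.card S),
      ∃ T ≤ S, T ≠ 0 ∧ T.sum = 0 := by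
  obtain ⟨N, hN⟩ := exists_forall_prime_exists_zero_sum_card_eq r hr hδ
  refine ⟨N, fun n => ?_⟩
  induction n using Nat.strong_induction_on with
  | _ n ih =>
    intro hn hnN G _ f hf hG S hS
    have hp : n.minFac.Prime := Nat.minFac_prime hn.ne'
    set p := n.minFac
    obtain ⟨m, hm⟩ : p ∣ n := Nat.minFac_dvd n
    have hm0 : 0 < m := Nat.pos_of_ne_zero fun h => by
      rw [h, mul_zero] at hm
      omega
    rcases (Nat.one_le_iff_ne_zero.2 hm0.ne').eq_or_lt' with hm1 | hm1
    · have hnp : n = p := by rw [hm, hm1, mul_one]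
      refine exists_zero_sum_of_prime hp f hf (fun g => hnp ▸ hG g) S ?_
      have h1 : (n : ℝ) = p := by exact_mod_cast hnp
      rw [h1, sub_self, mul_zero, add_zero] at hS
      have h2 : r * p ≤ Multiset.card S := by exact_mod_cast hS
      exact lt_of_lt_of_le (Nat.mul_lt_mul_of_pos_left (Nat.sub_lt hp.pos one_pos) hr) h2
    · set φ : G →+ G := nsmulAddMonoidHom p
      have hφ : ∀ g, φ g = p • g := fun _ => rfl
      set H : AddSubgroup G := φ.range
      have hmp : p ≤ m.minFac :=
        Nat.minFac_le_of_dvd (Nat.minFac_prime hm1.ne').two_le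
          ((Nat.minFac_dvd m).trans (hm ▸ dvd_mul_left m p))
      have hmn : m < n := by
        rw [hm]
        exact lt_mul_of_one_lt_left hm0 hp.one_lt
      have hquot : ∀ v : G ⧸ H, p • v = 0 := by
        intro v
        obtain ⟨g, rfl⟩ := QuotientAddGroup.mk_surjective v
        rw [← QuotientAddGroup.mk_nsmul, QuotientAddGroup.eq_zero_iff]
        exact ⟨g, rfl⟩
      have : NeZero p := ⟨hp.ne_zero⟩
      -- the quotient is an image of `(ℤ/pℤ)^r`
      set q : (Fin r → ℤ) →+ G ⧸ H := (QuotientAddGroup.mk' H).comp f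
      have hq : Function.Surjective q := (QuotientAddGroup.mk'_surjective H).comp hf
      set π : (Fin r → ℤ) →+ (Fin r → ZMod p) :=
        (Int.castAddHom (ZMod p)).compLeft (Fin r) with hπ
      have hπs : Function.Surjective π := fun y =>
        ⟨fun i => (y i).cast, funext fun i => by simp [hπ]⟩
      have hker : π.ker ≤ q.ker := by
        intro x hx
        have hdvd : ∀ i, (p : ℤ) ∣ x i := by
          intro i
          rw [← ZMod.intCast_zmod_eq_zero_iff_dvd]
          exact congrFun hx i
        choose c hc using hdvd
        have : x = p • c := by
          ext i
          rw [hc i]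
          simp
        rw [AddMonoidHom.mem_ker, this, map_nsmul, hquot]
      set g : (Fin r → ZMod p) →+ G ⧸ H :=
        AddMonoidHom.liftOfSurjective π hπs ⟨q, hker⟩
      have hgπ : ∀ x, g (π x) = q x := fun x =>
        AddMonoidHom.liftOfRightInverse_comp_apply π _ (Function.rightInverse_surjInv hπs) _ x
      have hgs : Function.Surjective g := fun v => by
        obtain ⟨x, rfl⟩ := hq v
        exact ⟨π x, hgπ x⟩
      have : Finite (G ⧸ H) := Finite.of_surjective g hgs
      have hcard : Nat.card (G ⧸ H) ∣ p ^ r := by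
        have := AddSubgroup.card_dvd_of_surjective g hgs
        simpa using this
      have hη : ∀ S : Multiset G, δ * (p : ℝ) ^ 2 ≤ Multiset.card S →
          ∃ T ≤ S, Multiset.card T = p ∧ T.sum ∈ H := by
        intro S hS
        obtain ⟨T, hT, hTc, hTs⟩ :=
          hN p hp hnN G (G ⧸ H) (QuotientAddGroup.mk' H) hquot hcard S hS
        exact ⟨T, hT, hTc, (QuotientAddGroup.eq_zero_iff _).1 hTs⟩
      set x : ℝ := r * (m : ℝ) + 2 * δ * (m - m.minFac) with hx
      have hpR : (0 : ℝ) < p := by exact_mod_cast hp.pos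
      have hp2 : (2 : ℝ) ≤ p := by exact_mod_cast hp.two_le
      have hmpR : (p : ℝ) ≤ m.minFac := by exact_mod_cast hmp
      have hx0 : 0 ≤ x := by
        have : (m.minFac : ℝ) ≤ m := by exact_mod_cast Nat.minFac_le hm0
        have : 0 ≤ (m : ℝ) - m.minFac := by linarith
        positivity
      have hS' : (p : ℝ) * ((⌈x⌉₊ : ℕ) - 1) + δ * (p : ℝ) ^ 2 ≤ Multiset.card S := by
        have h1 : ((⌈x⌉₊ : ℕ) : ℝ) - 1 ≤ x := by linarith [Nat.ceil_lt_add_one hx0]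
        have h2 : (n : ℝ) = p * m := by exact_mod_cast hm
        refine le_trans ?_ hS
        calc (p : ℝ) * ((⌈x⌉₊ : ℕ) - 1) + δ * (p : ℝ) ^ 2 ≤ p * x + δ * (p : ℝ) ^ 2 := by gcongr
          _ = r * (p * m) + 2 * δ * (p * m) - 2 * δ * (p * m.minFac) + δ * (p : ℝ) ^ 2 := by
            rw [hx]
            ring
          _ ≤ r * (p * m) + 2 * δ * (p * m) - 2 * δ * (p * p) + δ * (p : ℝ) ^ 2 := by gcongr
          _ ≤ r * (n : ℝ) + 2 * δ * (n - p) := by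
            rw [h2]
            nlinarith [mul_nonneg (mul_nonneg hδ.le hpR.le) (sub_nonneg.2 hp2)]
      obtain ⟨U, hUc, hU⟩ := exists_multiset_subgroup H hp.pos hη ⌈x⌉₊ S hS'
      obtain ⟨U', hU'U, hU'0, hU's⟩ := ih m hmn hm1 (hnN.trans hmp) H
        (φ.rangeRestrict.comp f) (φ.rangeRestrict_surjective.comp hf)
        (by
          rintro ⟨_, g, rfl⟩
          refine Subtype.ext ?_
          change m • (p • g) = 0
          rw [← mul_nsmul, ← hm, hG])
        U (by rw [hUc]; exact Nat.le_ceil x)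
      obtain ⟨T, hT, hTs, hT0⟩ := hU U' hU'U
      exact ⟨T, hT, fun h => hU'0 (hT0 h), by rw [hTs, hU's]; rfl⟩

theorem stmt16 (r : ℕ) (hr : 1 ≤ r) (l : Fin r → ℕ) (hl : ∀ i, 1 ≤ l i) :
    ∀ ε : ℝ, 0 < ε → ∃ N : ℕ, ∀ n : Fin r → ℕ,
      (∀ i, 1 < n i) → (∀ i j : Fin r, i ≤ j → n i ∣ n j) →
      (∀ i, (n i).primeFactors.card = l i) →
      (∀ i, Nat.gcd (n i) (n ⟨r - 1, by omega⟩ / n i) = 1) →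
      N ≤ (n ⟨r - 1, by omega⟩).minFac →
      (davenport (∀ i : Fin r, ZMod (n i)) : ℝ) ≤ (∑ i, (l i : ℝ) + ε) * (n ⟨r - 1, by omega⟩ : ℝ) := by
  intro ε hε
  obtain ⟨N, hN⟩ := exists_forall_exists_zero_sum r hr (δ := ε / 4) (by linarith)
  obtain ⟨M, hM⟩ := exists_nat_ge (2 / ε)
  refine ⟨max N M, fun n hn hdvd _ _ hNn => ?_⟩
  set k := n ⟨r - 1, by omega⟩
  have hk1 : 1 < k := hn _
  have hkR : (1 : ℝ) < k := by exact_mod_cast hk1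
  have hminFac : (k.minFac : ℝ) ≤ k := by exact_mod_cast Nat.minFac_le (by omega)
  have hrl : (r : ℝ) ≤ ∑ i, (l i : ℝ) := by
    have : ∑ _i : Fin r, 1 ≤ ∑ i, l i := Finset.sum_le_sum fun i _ => hl i
    rw [Finset.sum_const, Finset.card_univ, Fintype.card_fin, smul_eq_mul, mul_one] at this
    exact_mod_cast this
  have hr' : (1 : ℝ) ≤ r := by exact_mod_cast hr
  set f : (Fin r → ℤ) →+ (∀ i : Fin r, ZMod (n i)) :=
    { toFun := fun x i => (x i : ZMod (n i))
      map_zero' := by ext; simp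
      map_add' := by intros; ext; simp }
  have hf : Function.Surjective f := fun y =>
    ⟨fun i => (y i).cast, funext fun i => ZMod.intCast_zmod_cast (y i)⟩
  have hexp : ∀ g : (∀ i : Fin r, ZMod (n i)), k • g = 0 := by
    intro g
    ext i
    have : ((k : ℕ) : ZMod (n i)) = 0 :=
      (ZMod.natCast_eq_zero_iff _ _).2 (hdvd i _ (Fin.mk_le_mk.2 (by have := i.2; omega)))
    rw [Pi.smul_apply, nsmul_eq_mul, this, zero_mul, Pi.zero_apply]
  have hkM : 1 ≤ ε / 2 * k := by
    have h1 : (M : ℝ) ≤ k.minFac := by exact_mod_cast (le_max_right N M).trans hNn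
    have h2 : 2 / ε ≤ k := hM.trans (h1.trans hminFac)
    rw [div_le_iff₀ hε] at h2
    linarith
  set x : ℝ := r * (k : ℝ) + 2 * (ε / 4) * (k - k.minFac) with hx
  have hx0 : 0 < x := by
    have h1 : 0 < (r : ℝ) * k := by positivity
    have h2 : 0 ≤ 2 * (ε / 4) * (k - k.minFac) :=
      mul_nonneg (by positivity) (sub_nonneg.2 hminFac)
    linarith
  have hle : davenport (∀ i : Fin r, ZMod (n i)) ≤ ⌈x⌉₊ :=
    Nat.sInf_le ⟨Nat.one_le_ceil_iff.2 hx0, fun S hS =>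
      hN k hk1 ((le_max_left N M).trans hNn) _ f hf hexp S (Nat.ceil_le.1 hS)⟩
  have hceil : ((⌈x⌉₊ : ℕ) : ℝ) ≤ x + 1 := (Nat.ceil_lt_add_one hx0.le).le
  have hle' : (davenport (∀ i : Fin r, ZMod (n i)) : ℝ) ≤ (⌈x⌉₊ : ℕ) := by exact_mod_cast hle
  have hεm : 0 ≤ 2 * (ε / 4) * (k.minFac : ℝ) := by positivity
  calc (davenport (∀ i : Fin r, ZMod (n i)) : ℝ) ≤ x + 1 := hle'.trans hceil
    _ ≤ (r + ε) * k := by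
      rw [hx]
      nlinarith
    _ ≤ (∑ i, (l i : ℝ) + ε) * k := by gcongr
end

section
/- Fix an integer r ≥ 1. For every real ε > 0 there exists N such that every integer n ≥ 2 with ω(n) ≥ N satisfies |k(C_n^r)/ω(n) − r| < ε, where C_n^r denotes the direct sum of r copies of C_n. -/
open scoped BigOperators

attribute [local instance] Classical.propDecidable

/-- `∑ p ∈ P, ∏ q ∈ P, q ≥ p, (1 - 1/q)⁻¹`. -/
noncomputable def tailEulerSum (P : Finset ℕ) : ℝ :=
  ∑ p ∈ P, ∏ q ∈ P.filter (p ≤ ·), (1 - (q : ℝ)⁻¹)⁻¹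

lemma eventually_primeCounting_le_mul_sub_one {δ : ℝ} (hδ : 0 < δ) :
    ∃ X : ℕ, ∀ q : ℕ, X ≤ q → (Nat.primeCounting q : ℝ) ≤ δ * ((q : ℝ) - 1) := by
  have h1 := Chebyshev.eventually_primeCounting_le (ε := 1) one_pos
  have h2 : ∀ᶠ x : ℝ in Filter.atTop, 2 * (Real.log 4 + 1) / δ ≤ Real.log x :=
    Real.tendsto_log_atTop.eventually_ge_atTop _
  have h3 : ∀ᶠ x : ℝ in Filter.atTop, 2 ≤ x := Filter.eventually_ge_atTop 2
  have h4 := tendsto_natCast_atTop_atTop (R := ℝ) |>.eventually (h1.and (h2.and h3))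
  obtain ⟨X, hX⟩ := Filter.eventually_atTop.1 h4
  refine ⟨X, fun q hq => ?_⟩
  obtain ⟨a, b, c⟩ := hX q hq
  rw [Nat.floor_natCast] at a
  have hl4 : 0 < Real.log 4 := Real.log_pos (by norm_num)
  have hlog : 0 < Real.log q := Real.log_pos (by linarith)
  refine a.trans ?_
  rw [div_le_iff₀ hδ] at b
  rw [div_le_iff₀ hlog]
  nlinarith [mul_le_mul_of_nonneg_right b (show (0:ℝ) ≤ (q:ℝ) - 1 by linarith)]

lemma one_le_inv_one_sub_inv {q : ℕ} (hq : 2 ≤ q) :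
    1 ≤ (1 - (q : ℝ)⁻¹)⁻¹ ∧ (1 - (q : ℝ)⁻¹)⁻¹ ≤ 2 ∧
      (1 - (q : ℝ)⁻¹)⁻¹ = 1 + 1 / ((q : ℝ) - 1) := by
  have h : (2 : ℝ) ≤ q := by exact_mod_cast hq
  have e : (1 - (q : ℝ)⁻¹)⁻¹ = 1 + 1 / ((q : ℝ) - 1) := by
    have : (q : ℝ) - 1 ≠ 0 := by linarith
    have h0 : (q : ℝ) ≠ 0 := by linarith
    field_simp
    ring
  have h1 : 0 < 1 / ((q : ℝ) - 1) := by apply one_div_pos.2; linarith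
  have h2 : 1 / ((q : ℝ) - 1) ≤ 1 := by rw [div_le_one] <;> linarith
  refine ⟨?_, ?_, e⟩ <;> rw [e] <;> linarith

lemma tailEulerSum_insert {P : Finset ℕ} {q : ℕ} (h : ∀ x ∈ P, x < q) :
    tailEulerSum (insert q P) = (1 - (q : ℝ)⁻¹)⁻¹ * (tailEulerSum P + 1) := by
  have hq : q ∉ P := fun hq => (h q hq).false
  unfold tailEulerSum
  rw [Finset.sum_insert hq]
  have e1 : (insert q P).filter (q ≤ ·) = {q} := by
    ext x
    simp only [Finset.mem_filter, Finset.mem_insert, Finset.mem_singleton]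
    constructor
    · rintro ⟨rfl | hx, h2⟩
      · rfl
      · exact absurd (h x hx) (by omega)
    · rintro rfl; simp
  have e2 : ∀ p ∈ P, ∏ x ∈ (insert q P).filter (p ≤ ·), (1 - (x : ℝ)⁻¹)⁻¹ =
      (1 - (q : ℝ)⁻¹)⁻¹ * ∏ x ∈ P.filter (p ≤ ·), (1 - (x : ℝ)⁻¹)⁻¹ := by
    intro p hp
    rw [Finset.filter_insert, if_pos (h p hp).le, Finset.prod_insert (by simp [hq])]
  rw [e1, Finset.sum_congr rfl e2, ← Finset.mul_sum]
  simp
  ring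

lemma tailEulerSum_le_of_lt {P : Finset ℕ} (hP : ∀ p ∈ P, p.Prime) {X : ℕ}
    (h : ∀ p ∈ P, p < X) : tailEulerSum P ≤ X * 2 ^ X := by
  have hc : P.card ≤ X := by
    simpa using Finset.card_le_card (fun x hx => Finset.mem_range.2 (h x hx) : P ⊆ Finset.range X)
  unfold tailEulerSum
  have : ∀ p ∈ P, ∏ q ∈ P.filter (p ≤ ·), (1 - (q : ℝ)⁻¹)⁻¹ ≤ 2 ^ X := by
    intro p _
    have hc' : (P.filter (p ≤ ·)).card ≤ X := (Finset.card_filter_le _ _).trans hc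
    calc _ ≤ ∏ q ∈ P.filter (p ≤ ·), (2 : ℝ) := by
          apply Finset.prod_le_prod
          · intro q hq
            have := (one_le_inv_one_sub_inv (hP q (Finset.mem_filter.1 hq).1).two_le).1
            linarith
          · intro q hq
            exact (one_le_inv_one_sub_inv (hP q (Finset.mem_filter.1 hq).1).two_le).2.1
      _ = 2 ^ (P.filter (p ≤ ·)).card := by simp
      _ ≤ 2 ^ X := pow_le_pow_right₀ (by norm_num) hc'
  calc _ ≤ ∑ p ∈ P, (2 : ℝ) ^ X := Finset.sum_le_sum this
    _ = P.card * 2 ^ X := by simp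
    _ ≤ _ := by gcongr

lemma card_lt_primeCounting {P : Finset ℕ} {q : ℕ} (hP : ∀ p ∈ P, p.Prime) (hq : q.Prime)
    (h : ∀ x ∈ P, x < q) : P.card + 1 ≤ Nat.primeCounting q := by
  have hq' : q ∉ P := fun hq => (h q hq).false
  rw [← Finset.card_insert_of_notMem hq', ← Nat.primesLE_card_eq_primeCounting]
  apply Finset.card_le_card
  intro x hx
  rw [Nat.mem_primesLE]
  rcases Finset.mem_insert.1 hx with rfl | hx
  · exact ⟨le_rfl, hq⟩
  · exact ⟨(h x hx).le, hP x hx⟩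

lemma exists_tailEulerSum_le {δ : ℝ} (hδ : 0 < δ) (hδ' : δ ≤ 1 / 4) :
    ∃ B : ℝ, 0 ≤ B ∧ ∀ P : Finset ℕ, (∀ p ∈ P, p.Prime) →
      tailEulerSum P ≤ (1 + 2 * δ) * P.card + B * √P.card := by
  obtain ⟨X, hX⟩ := eventually_primeCounting_le_mul_sub_one hδ
  refine ⟨X * 2 ^ X, by positivity, fun P => ?_⟩
  induction P using Finset.induction_on_max with
  | empty => simp [tailEulerSum]
  | insert q P hlt ih =>
    intro hP
    have hqP : q ∉ P := fun hq => (hlt q hq).false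
    have hq : q.Prime := hP q (Finset.mem_insert_self _ _)
    have hP' : ∀ p ∈ P, p.Prime := fun p hp => hP p (Finset.mem_insert_of_mem hp)
    specialize ih hP'
    set B : ℝ := X * 2 ^ X with hB
    have hB0 : 0 ≤ B := by positivity
    rw [Finset.card_insert_of_notMem hqP]
    set w : ℝ := (P.card : ℝ) with hw
    have hw0 : 0 ≤ w := by positivity
    push_cast
    rw [← hw]
    have hs1 : 1 ≤ √(w + 1) := by rw [Real.one_le_sqrt]; linarith
    by_cases hqX : q < X
    · have := tailEulerSum_le_of_lt hP (X := X) (by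
        intro p hp
        rcases Finset.mem_insert.1 hp with rfl | hp
        · exact hqX
        · exact (hlt p hp).trans hqX)
      nlinarith
    · push Not at hqX
      rw [tailEulerSum_insert hlt, (one_le_inv_one_sub_inv hq.two_le).2.2]
      have h1 : w + 1 ≤ δ * ((q : ℝ) - 1) := by
        refine le_trans ?_ (hX q hqX)
        rw [hw]
        exact_mod_cast card_lt_primeCounting hP' hq hlt
      have hq2 : (2 : ℝ) ≤ q := by exact_mod_cast hq.two_le
      have hu : 1 / ((q : ℝ) - 1) ≤ δ / (w + 1) := by
        rw [div_le_div_iff₀ (by linarith) (by linarith)]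
        linarith
      set s := √w
      set t := √(w + 1)
      have hs : s ^ 2 = w := Real.sq_sqrt hw0
      have ht : t ^ 2 = w + 1 := Real.sq_sqrt (by linarith)
      have hs0 : 0 ≤ s := Real.sqrt_nonneg _
      have hst : s ≤ t := Real.sqrt_le_sqrt (by linarith)
      calc (1 + 1 / ((q : ℝ) - 1)) * (tailEulerSum P + 1)
          ≤ (1 + δ / (w + 1)) * ((1 + 2 * δ) * w + B * s + 1) := by
            have : 0 ≤ (1 + 2 * δ) * w + B * s + 1 := by positivity
            have h0 : 0 < 1 / ((q : ℝ) - 1) := by apply one_div_pos.2; linarith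
            apply mul_le_mul (by linarith) (by linarith) _ (by positivity)
            have : 0 ≤ tailEulerSum P := by
              unfold tailEulerSum
              refine Finset.sum_nonneg fun p _ => Finset.prod_nonneg fun q hq => ?_
              have := (one_le_inv_one_sub_inv (hP' q (Finset.mem_filter.1 hq).1).two_le).1
              linarith
            linarith
        _ ≤ (1 + 2 * δ) * (w + 1) + B * t := by
            have hw1 : 0 < w + 1 := by linarith
            have k1 : δ / (w + 1) * ((1 + 2 * δ) * w + 1) ≤ 2 * δ := by
              rw [div_mul_eq_mul_div, div_le_iff₀ hw1]
              nlinarith [mul_nonneg hδ.le hw0, mul_nonneg (mul_nonneg hδ.le hw0) (sub_nonneg.2 hδ')]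
            have k2 : s + δ / (w + 1) * s ≤ t := by
              have : δ / (w + 1) * s ≤ t - s := by
                rw [div_mul_eq_mul_div, div_le_iff₀ hw1]
                have e : (t - s) * (t + s) = 1 := by nlinarith
                have e0 : 0 ≤ t - s := by linarith
                have e2 : 1 ≤ (t - s) * (2 * t) := by nlinarith
                have e3 : t ≤ 2 * ((t - s) * (w + 1)) := by
                  rw [← ht]; nlinarith
                nlinarith
              linarith
            nlinarith [mul_le_mul_of_nonneg_left k2 hB0]

lemma exists_tailEulerSum_sub_card_le {ε : ℝ} (hε : 0 < ε) :
    ∃ N : ℕ, ∀ P : Finset ℕ, (∀ p ∈ P, p.Prime) → N ≤ P.card →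
      tailEulerSum P - P.card ≤ ε * P.card := by
  obtain ⟨B, hB, h⟩ := exists_tailEulerSum_le (δ := min (1 / 4) (ε / 4))
    (by positivity) (min_le_left _ _)
  obtain ⟨N, hN⟩ := exists_nat_ge ((2 * B / ε) ^ 2)
  refine ⟨N, fun P hP hc => ?_⟩
  have h1 := h P hP
  have h2 : min (1 / 4) (ε / 4) ≤ ε / 4 := min_le_right _ _
  set w : ℝ := (P.card : ℝ)
  have hw0 : 0 ≤ w := by positivity
  have h3 : (2 * B / ε) ^ 2 ≤ w := hN.trans (Nat.cast_le.2 hc)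
  have h4 : 2 * B / ε ≤ √w := Real.le_sqrt_of_sq_le h3
  rw [div_le_iff₀ hε] at h4
  have h5 : √w * √w = w := Real.mul_self_sqrt hw0
  have h6 : 0 ≤ √w := Real.sqrt_nonneg _
  nlinarith [mul_le_mul_of_nonneg_right h2 hw0, mul_le_mul_of_nonneg_right h4 h6]

lemma sum_inv_le_tailEulerSum_sub_card {P : Finset ℕ} (hP : ∀ p ∈ P, p.Prime) :
    ∑ p ∈ P, (p : ℝ)⁻¹ ≤ tailEulerSum P - P.card := by
  have : tailEulerSum P - P.card =
      ∑ p ∈ P, (∏ q ∈ P.filter (p ≤ ·), (1 - (q : ℝ)⁻¹)⁻¹ - 1) := by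
    simp [tailEulerSum, Finset.sum_sub_distrib]
  rw [this]
  refine Finset.sum_le_sum fun p hp => ?_
  have hp2 : (2 : ℝ) ≤ p := by exact_mod_cast (hP p hp).two_le
  have h1 : (1 - (p : ℝ)⁻¹)⁻¹ ≤ ∏ q ∈ P.filter (p ≤ ·), (1 - (q : ℝ)⁻¹)⁻¹ := by
    rw [← Finset.mul_prod_erase (P.filter (p ≤ ·)) _ (a := p) (by simp [hp])]
    have h2 := (one_le_inv_one_sub_inv (hP p hp).two_le).1
    refine le_mul_of_one_le_right (by linarith) ?_
    refine Finset.prod_induction _ (fun x : ℝ => 1 ≤ x)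
      (fun a b ha hb => by nlinarith) le_rfl ?_
    intro q hq
    simp only [Finset.mem_erase, Finset.mem_filter] at hq
    exact (one_le_inv_one_sub_inv (hP q hq.2.1).two_le).1
  have h3 : (p : ℝ)⁻¹ ≤ 1 / ((p : ℝ) - 1) := by
    rw [inv_eq_one_div]
    exact one_div_le_one_div_of_le (by linarith) (by linarith)
  rw [(one_le_inv_one_sub_inv (hP p hp).two_le).2.2] at h1
  linarith

/-- The completely multiplicative function `n ↦ 1/n`. -/
noncomputable def natInvHom : ℕ →* ℝ where
  toFun n := (n : ℝ)⁻¹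
  map_one' := by simp
  map_mul' a b := by simp [mul_comm]

lemma sum_inv_le_prod_of_subset_factoredNumbers {Q E : Finset ℕ} (hQ : ∀ p ∈ Q, p.Prime)
    (hE : ∀ e ∈ E, e ∈ Nat.factoredNumbers Q) :
    ∑ e ∈ E, (e : ℝ)⁻¹ ≤ ∏ q ∈ Q, (1 - (q : ℝ)⁻¹)⁻¹ := by
  have h := (EulerProduct.summable_and_hasSum_factoredNumbers_prod_filter_prime_geometric
    (f := natInvHom) (by
      intro p hp
      have : (1 : ℝ) < p := by exact_mod_cast hp.one_lt
      simpa [natInvHom] using inv_lt_one_of_one_lt₀ this) Q).2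
  rw [Finset.filter_true_of_mem hQ] at h
  have h2 := sum_le_hasSum (E.subtype (· ∈ Nat.factoredNumbers Q))
    (fun i _ => by simp [natInvHom]) h
  refine le_trans (le_of_eq ?_) h2
  rw [Finset.sum_subtype_of_mem (f := fun e : ℕ => natInvHom e) hE]
  rfl

lemma sum_minFac_div_le {n : ℕ} (hn : n ≠ 0) :
    ∑ d ∈ n.divisors.filter (fun d => d ≠ 1 ∧ ¬ d.Prime), (d.minFac : ℝ) / d ≤
      tailEulerSum n.primeFactors - n.primeFactors.card := by
  have : tailEulerSum n.primeFactors - n.primeFactors.card =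
      ∑ p ∈ n.primeFactors,
        (∏ q ∈ n.primeFactors.filter (p ≤ ·), (1 - (q : ℝ)⁻¹)⁻¹ - 1) := by
    simp [tailEulerSum, Finset.sum_sub_distrib]
  rw [this, ← Finset.sum_fiberwise_of_maps_to (t := n.primeFactors) (g := Nat.minFac)]
  swap
  · intro d hd
    simp only [Finset.mem_filter, Nat.mem_divisors] at hd
    exact Nat.mem_primeFactors.2
      ⟨Nat.minFac_prime hd.2.1, (Nat.minFac_dvd d).trans hd.1.1, hn⟩
  refine Finset.sum_le_sum fun p hp => ?_
  set D := (n.divisors.filter (fun d => d ≠ 1 ∧ ¬ d.Prime)).filter (fun d => d.minFac = p)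
  have hpp : p.Prime := (Nat.mem_primeFactors.1 hp).1
  have hD : ∀ d ∈ D, ∃ e, d = p * e ∧ e ≠ 1 ∧ e ≠ 0 ∧
      e ∈ Nat.factoredNumbers (n.primeFactors.filter (p ≤ ·)) := by
    intro d hd
    simp only [D, Finset.mem_filter, Nat.mem_divisors] at hd
    obtain ⟨⟨⟨hdn, _⟩, hd1, hdp⟩, hm⟩ := hd
    obtain ⟨e, rfl⟩ : p ∣ d := hm ▸ Nat.minFac_dvd d
    have he0 : e ≠ 0 := by rintro rfl; simp [hn] at hdn
    refine ⟨e, rfl, ?_, he0, ?_⟩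
    · rintro rfl; simp [hpp] at hdp
    · rw [Nat.mem_factoredNumbers']
      intro q hq hqe
      simp only [Finset.mem_filter, Nat.mem_primeFactors]
      refine ⟨⟨hq, (hqe.mul_left p).trans hdn, hn⟩, ?_⟩
      rw [← hm]
      exact Nat.minFac_le_of_dvd hq.two_le (hqe.mul_left p)
  have hinj : Set.InjOn (fun d => d / p) D := by
    intro a ha b hb hab
    obtain ⟨e, rfl, -⟩ := hD a ha
    obtain ⟨f, rfl, -⟩ := hD b hb
    simp only [Nat.mul_div_cancel_left _ hpp.pos] at hab
    rw [hab]
  have h1 : (1 : ℕ) ∉ D.image (fun d => d / p) := by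
    intro h
    obtain ⟨d, hd, h⟩ := Finset.mem_image.1 h
    obtain ⟨e, rfl, he, -⟩ := hD d hd
    rw [Nat.mul_div_cancel_left _ hpp.pos] at h
    exact he h
  have key := sum_inv_le_prod_of_subset_factoredNumbers
    (Q := n.primeFactors.filter (p ≤ ·)) (E := insert 1 (D.image (fun d => d / p)))
    (fun q hq => (Nat.mem_primeFactors.1 (Finset.mem_filter.1 hq).1).1) (by
      intro e he
      rcases Finset.mem_insert.1 he with rfl | he
      · simp [Nat.mem_factoredNumbers]
      · obtain ⟨d, hd, rfl⟩ := Finset.mem_image.1 he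
        obtain ⟨e, rfl, -, -, he⟩ := hD d hd
        simpa only [Nat.mul_div_cancel_left _ hpp.pos] using he)
  rw [Finset.sum_insert h1, Finset.sum_image hinj] at key
  have : ∑ d ∈ D, (d.minFac : ℝ) / d = ∑ d ∈ D, ((d / p : ℕ) : ℝ)⁻¹ := by
    refine Finset.sum_congr rfl fun d hd => ?_
    have hm : d.minFac = p := (Finset.mem_filter.1 hd).2
    rw [hm]
    obtain ⟨e, rfl, -, he, -⟩ := hD d hd
    rw [Nat.mul_div_cancel_left _ hpp.pos]
    have : (p : ℝ) ≠ 0 := by exact_mod_cast hpp.ne_zero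
    have : (e : ℝ) ≠ 0 := by exact_mod_cast he
    push_cast
    field_simp
  rw [this]
  simp only [Nat.cast_one, inv_one] at key
  linarith

/-- The number of `y ∈ Y` that leave `Y` under translation by `g`. -/
noncomputable def shiftLoss {V : Type*} [AddCommGroup V] (Y : Finset V) (g : V) : ℕ :=
  (Y.filter (fun y => y + g ∉ Y)).card

section shiftLoss

variable {V : Type*} [AddCommGroup V]

lemma card_filter_add_mem_add_shiftLoss (Y : Finset V) (g : V) :
    (Y.filter (fun y => y + g ∈ Y)).card + shiftLoss Y g = Y.card := by
  unfold shiftLoss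
  exact Finset.card_filter_add_card_filter_not (s := Y) (fun y => y + g ∈ Y)

lemma shiftLoss_zero (Y : Finset V) : shiftLoss Y 0 = 0 := by
  simp [shiftLoss]

lemma shiftLoss_add_le (Y : Finset V) (g h : V) :
    shiftLoss Y (g + h) ≤ shiftLoss Y g + shiftLoss Y h := by
  unfold shiftLoss
  have : (Y.filter (fun y => y + (g + h) ∉ Y)) ⊆ (Y.filter (fun y => y + g ∉ Y)) ∪
      (Y.filter (fun y => y + h ∉ Y)).image (fun y : V => y - g) := by
    intro y hy
    simp only [Finset.mem_filter, Finset.mem_union, Finset.mem_image] at hy ⊢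
    by_cases hg : y + g ∈ Y
    · right
      refine ⟨y + g, ⟨hg, ?_⟩, by abel⟩
      rw [add_assoc]
      exact hy.2
    · exact Or.inl ⟨hy.1, hg⟩
  refine (Finset.card_le_card this).trans ((Finset.card_union_le _ _).trans ?_)
  exact Nat.add_le_add_left Finset.card_image_le _

lemma shiftLoss_nsmul_le (Y : Finset V) (k : ℕ) (g : V) :
    shiftLoss Y (k • g) ≤ k * shiftLoss Y g := by
  induction k with
  | zero => simp [shiftLoss_zero]
  | succ k ih =>
    rw [succ_nsmul]
    refine (shiftLoss_add_le _ _ _).trans ?_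
    linarith

lemma shiftLoss_sum_le {ι : Type*} (Y : Finset V) (s : Finset ι) (f : ι → V) :
    shiftLoss Y (∑ i ∈ s, f i) ≤ ∑ i ∈ s, shiftLoss Y (f i) := by
  induction s using Finset.induction_on with
  | empty => simp [shiftLoss_zero]
  | insert i s hi ih =>
    rw [Finset.sum_insert hi, Finset.sum_insert hi]
    exact (shiftLoss_add_le _ _ _).trans (by linarith)

lemma exists_card_le_two_mul_shiftLoss {Y T : Finset V} (hT : T.Nonempty)
    (h : 2 * Y.card ≤ T.card) : ∃ g ∈ T, Y.card ≤ 2 * shiftLoss Y g := by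
  by_contra! hcon
  have h1 : ∑ g ∈ T, (Y.filter (fun y => y + g ∈ Y)).card ≤ Y.card * Y.card := by
    simp_rw [Finset.card_filter]
    rw [Finset.sum_comm]
    calc _ ≤ ∑ y ∈ Y, Y.card := by
          refine Finset.sum_le_sum fun y _ => ?_
          rw [← Finset.card_filter]
          refine Finset.card_le_card_of_injOn (fun g => y + g) ?_ ?_
          · intro g hg
            exact (Finset.mem_filter.1 hg).2
          · intro g _ g' _ hgg
            exact add_left_cancel hgg
      _ = Y.card * Y.card := by simp
  have h2 : ∑ g ∈ T, (Y.card + 1) ≤ ∑ g ∈ T, 2 * (Y.filter (fun y => y + g ∈ Y)).card := by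
    refine Finset.sum_le_sum fun g hg => ?_
    have := hcon g hg
    have := card_filter_add_mem_add_shiftLoss Y g
    omega
  rw [← Finset.mul_sum] at h2
  simp only [Finset.sum_const, smul_eq_mul] at h2
  have := hT.card_pos
  nlinarith

lemma exists_card_le_mul_shiftLoss_of_linearIndependent {p d m : ℕ} [Fact p.Prime]
    [Module (ZMod p) V] {b : Fin d → V} (hb : LinearIndependent (ZMod p) b) (hd : 0 < d)
    (hm : 1 ≤ m) (hmp : m ≤ p) {Y : Finset V} (hY : 2 * Y.card ≤ m ^ d) :
    ∃ i, Y.card ≤ 2 * m * d * shiftLoss Y (b i) := by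
  let φ : (Fin d → Fin m) → V := fun k => ∑ i, (k i : ℕ) • b i
  have hφ : Function.Injective φ := by
    intro k l hkl
    have h1 : ∑ i, (((k i : ℕ) : ZMod p) - ((l i : ℕ) : ZMod p)) • b i = 0 := by
      simp only [sub_smul, Finset.sum_sub_distrib, Nat.cast_smul_eq_nsmul]
      exact sub_eq_zero.2 hkl
    have h2 := Fintype.linearIndependent_iff.1 hb _ h1
    funext i
    have h3 := sub_eq_zero.1 (h2 i)
    rw [ZMod.natCast_eq_natCast_iff'] at h3
    rw [Nat.mod_eq_of_lt ((k i).2.trans_le hmp), Nat.mod_eq_of_lt ((l i).2.trans_le hmp)] at h3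
    exact Fin.ext h3
  have : NeZero m := ⟨by omega⟩
  obtain ⟨g, hg, hle⟩ := exists_card_le_two_mul_shiftLoss (Y := Y)
    (T := (Finset.univ : Finset (Fin d → Fin m)).image φ) (Finset.univ_nonempty.image _) (by
      rw [Finset.card_image_of_injective _ hφ]
      simpa using hY)
  obtain ⟨k, -, rfl⟩ := Finset.mem_image.1 hg
  by_contra! hcon
  have h1 : shiftLoss Y (φ k) ≤ ∑ i, m * shiftLoss Y (b i) := by
    refine (shiftLoss_sum_le _ _ _).trans (Finset.sum_le_sum fun i _ => ?_)
    exact (shiftLoss_nsmul_le _ _ _).trans (by gcongr; exact (k i).2.le)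
  have : Nonempty (Fin d) := ⟨⟨0, hd⟩⟩
  have h2 : ∑ i, 2 * m * d * shiftLoss Y (b i) < ∑ _i : Fin d, Y.card :=
    Finset.sum_lt_sum_of_nonempty Finset.univ_nonempty fun i _ => hcon i
  rw [← Finset.mul_sum] at h1 h2
  simp only [Finset.sum_const, Finset.card_univ, Fintype.card_fin, smul_eq_mul] at h2
  have h3 := Nat.mul_le_mul_left d (hle.trans (Nat.mul_le_mul_left 2 h1))
  nlinarith

end shiftLoss

lemma card_mul_card_filter_add_mem {V : Type*} [AddCommGroup V] [Fintype V]
    (Y : Finset V) (g : V) :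
    (Fintype.card V : ℝ) * (Y.filter (fun y => y + g ∈ Y)).card =
      ∑ ψ : AddChar V ℂ, ‖∑ y ∈ Y, ψ y‖ ^ 2 * (ψ g).re := by
  have h1 : (Fintype.card V : ℂ) * (Y.filter (fun y => y + g ∈ Y)).card =
      ∑ ψ : AddChar V ℂ, ((‖∑ y ∈ Y, ψ y‖ ^ 2 : ℝ) : ℂ) * ψ g := by
    have h2 : ∀ ψ : AddChar V ℂ, ((‖∑ y ∈ Y, ψ y‖ ^ 2 : ℝ) : ℂ) * ψ g =
        ∑ y ∈ Y, ∑ y' ∈ Y, ψ (y + g - y') := by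
      intro ψ
      rw [Complex.ofReal_pow, ← Complex.mul_conj', map_sum, Finset.sum_mul_sum, Finset.sum_mul]
      refine Finset.sum_congr rfl fun y _ => ?_
      rw [Finset.sum_mul]
      refine Finset.sum_congr rfl fun y' _ => ?_
      rw [sub_eq_add_neg, AddChar.map_add_eq_mul, AddChar.map_add_eq_mul, AddChar.map_neg_eq_conj]
      ring
    simp_rw [h2]
    rw [Finset.sum_comm]
    have h3 : ∀ y ∈ Y, ∑ ψ : AddChar V ℂ, ∑ y' ∈ Y, ψ (y + g - y') =
        if y + g ∈ Y then (Fintype.card V : ℂ) else 0 := by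
      intro y _
      rw [Finset.sum_comm]
      simp_rw [AddChar.sum_apply_eq_ite, sub_eq_zero]
      rw [Finset.sum_ite_eq]
    rw [Finset.sum_congr rfl h3, ← Finset.sum_filter]
    simp [mul_comm]
  have h4 := congrArg Complex.re h1
  rw [Complex.re_sum] at h4
  simp only [Complex.re_ofReal_mul] at h4
  rw [← h4]
  simp

lemma four_mul_div_le_norm_one_sub_exp {p j J : ℕ} (hp : 0 < p) (h1 : J ≤ j) (h2 : j + J ≤ p) :
    4 * (J : ℝ) / p ≤ ‖1 - Complex.exp (2 * Real.pi * Complex.I * (j / p))‖ := by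
  have hp' : (0 : ℝ) < p := by exact_mod_cast hp
  have e : (2 * Real.pi * Complex.I * (j / p) : ℂ) =
      Complex.I * ((2 * Real.pi * (j / p) : ℝ) : ℂ) := by push_cast; ring
  rw [norm_sub_rev, e, Complex.norm_exp_I_mul_ofReal_sub_one]
  have e2 : 2 * Real.pi * (j / p : ℝ) / 2 = Real.pi * (j / p) := by ring
  have h1' : (J : ℝ) ≤ j := by exact_mod_cast h1
  have h2' : (j : ℝ) + J ≤ p := by exact_mod_cast h2
  rw [e2, norm_mul, Real.norm_ofNat, Real.norm_eq_abs]
  have hpi := Real.pi_pos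
  have key : 2 * ((J : ℝ) / p) ≤ Real.sin (Real.pi * (j / p)) := by
    rcases le_total (2 * (j : ℝ)) p with h | h
    · have := Real.mul_le_sin (x := Real.pi * (j / p)) (by positivity) (by
        have : (j : ℝ) / p ≤ 1 / 2 := by rw [div_le_div_iff₀] <;> linarith
        nlinarith)
      refine le_trans ?_ this
      have e3 : 2 / Real.pi * (Real.pi * (j / p)) = 2 * ((j : ℝ) / p) := by field_simp
      rw [e3]
      gcongr
    · rw [← Real.sin_pi_sub]
      have hle : (j : ℝ) / p ≤ 1 := by rw [div_le_one hp']; have : (0:ℝ) ≤ J := by positivity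
                                       linarith
      have := Real.mul_le_sin (x := Real.pi - Real.pi * (j / p)) (by nlinarith) (by
        have : 1 / 2 ≤ (j : ℝ) / p := by rw [div_le_div_iff₀] <;> linarith
        nlinarith)
      refine le_trans ?_ this
      have e3 : 2 / Real.pi * (Real.pi - Real.pi * (j / p)) = 2 * (((p : ℝ) - j) / p) := by
        field_simp
      rw [e3]
      gcongr
      linarith
  calc 4 * (J : ℝ) / p = 2 * (2 * (J / p)) := by ring
    _ ≤ _ := by gcongr; exact key.trans (le_abs_self _)

lemma exists_finset_roots_near_one {p : ℕ} (hp : 0 < p) (J : ℕ) :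
    ∃ R : Finset ℂ, R.card ≤ 2 * J ∧
      ∀ z : ℂ, z ^ p = 1 → z ∉ R → 4 * (J : ℝ) / p ≤ ‖1 - z‖ := by
  let e : ℕ → ℂ := fun j => Complex.exp (2 * Real.pi * Complex.I * (j / p))
  refine ⟨(Finset.range J).image e ∪ (Finset.range J).image (fun j => e (p - 1 - j)), ?_, ?_⟩
  · refine (Finset.card_union_le _ _).trans ?_
    have h1 := Finset.card_image_le (s := Finset.range J) (f := e)
    have h2 := Finset.card_image_le (s := Finset.range J) (f := fun j => e (p - 1 - j))
    simp only [Finset.card_range] at h1 h2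
    omega
  · intro z hz hzR
    have : NeZero p := ⟨hp.ne'⟩
    have hprim := Complex.isPrimitiveRoot_exp p hp.ne'
    obtain ⟨j, hj, rfl⟩ := hprim.eq_pow_of_pow_eq_one hz
    have hej : Complex.exp (2 * Real.pi * Complex.I / p) ^ j = e j := by
      rw [← Complex.exp_nat_mul]
      simp only [e]
      congr 1
      ring
    rw [hej] at hzR ⊢
    simp only [Finset.mem_union, Finset.mem_image, Finset.mem_range, not_or, not_exists,
      not_and] at hzR
    have hJj : J ≤ j := by
      by_contra! h
      exact hzR.1 j h rfl
    have hJp : j + J ≤ p := by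
      by_contra! h
      refine hzR.2 (p - 1 - j) (by omega) ?_
      congr 1
      omega
    exact four_mul_div_le_norm_one_sub_exp hp hJj hJp

lemma sum_range_re_pow_le {z : ℂ} {K : ℕ} (hz : 4 / (K : ℝ) ≤ ‖1 - z‖) (hK : 0 < K)
    (hz1 : ‖z‖ = 1) :
    ∑ k ∈ Finset.range K, (z ^ k).re ≤ K / 2 := by
  have hK' : (0 : ℝ) < K := by exact_mod_cast hK
  have hpos : 0 < ‖1 - z‖ := lt_of_lt_of_le (by positivity) hz
  have hne : z ≠ 1 := by
    rintro rfl
    simp at hpos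
  rw [← Complex.re_sum, geom_sum_eq hne]
  refine (Complex.re_le_norm _).trans ?_
  rw [norm_div, norm_sub_rev z 1, div_le_iff₀ hpos]
  have h2 : ‖z ^ K - 1‖ ≤ 2 := by
    refine (norm_sub_le _ _).trans ?_
    rw [norm_pow, hz1]
    norm_num
  rw [div_le_iff₀ hK'] at hz
  nlinarith

/-- A family of elements which does not concentrate on cosets of proper subgroups has
differences by which any set of density at most `1/2` is substantially moved. -/
lemma exists_card_le_mul_shiftLoss_sub {p : ℕ} [Fact p.Prime] {V ι : Type*} [AddCommGroup V]
    [Fintype V] (hpV : ∀ v : V, p • v = 0) {s : Finset ι} {a : ι → V} {J K L : ℕ} (hs : s.Nonempty)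
    (hL : ∀ H : AddSubgroup V, H ≠ ⊤ → ∀ v, (s.filter (fun i => a i - v ∈ H)).card ≤ L)
    (hsL : 4 * J * L ≤ s.card) (hK : 0 < K) (hJK : p ≤ J * K)
    {Y : Finset V} (hY : 2 * Y.card ≤ Fintype.card V) :
    ∃ i ∈ s, ∃ j ∈ s, Y.card ≤ 8 * K * shiftLoss Y (a i - a j) := by
  have hp : 0 < p := (Fact.out : p.Prime).pos
  set M : ℝ := (s.card : ℝ) with hM
  have hM0 : 0 < M := by rw [hM]; exact_mod_cast hs.card_pos
  have hK' : (0 : ℝ) < K := by exact_mod_cast hK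
  set N : ℝ := (Fintype.card V : ℝ) with hN
  have hN0 : 0 < N := by rw [hN]; exact_mod_cast Fintype.card_pos
  have hJ : (p : ℝ) ≤ J * K := by exact_mod_cast hJK
  have hp' : (0 : ℝ) < p := by exact_mod_cast hp
  obtain ⟨R, hRc, hR⟩ := exists_finset_roots_near_one hp J
  have hchar : ∀ (ψ : AddChar V ℂ) (v : V), ψ v ^ p = 1 := by
    intro ψ v
    rw [← AddChar.map_nsmul_eq_pow, hpV, AddChar.map_zero_eq_one]
  have hnorm : ∀ (ψ : AddChar V ℂ) (v : V), ‖ψ v‖ = 1 := fun ψ v => AddChar.norm_apply ψ v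
  have hpt : ∀ (ψ : AddChar V ℂ) (v : V), ∑ k ∈ Finset.range K, (ψ (k • v)).re ≤ K := by
    intro ψ v
    calc _ ≤ ∑ k ∈ Finset.range K, (1 : ℝ) := by
          refine Finset.sum_le_sum fun k _ => ?_
          exact (Complex.re_le_norm _).trans (hnorm _ _).le
      _ = K := by simp
  have hψ : ∀ ψ : AddChar V ℂ, ψ ≠ 0 → ∀ i,
      ∑ j ∈ s, ∑ k ∈ Finset.range K, (ψ (k • (a i - a j))).re ≤ 3 / 4 * (M * K) := by
    intro ψ hψ0 i
    let H : AddSubgroup V :=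
      { carrier := {v | ψ v = 1}
        zero_mem' := AddChar.map_zero_eq_one ψ
        add_mem' := by
          intro x y hx hy
          simp only [Set.mem_ofPred_eq] at hx hy ⊢
          rw [AddChar.map_add_eq_mul, hx, hy, one_mul]
        neg_mem' := by
          intro x hx
          simp only [Set.mem_ofPred_eq] at hx ⊢
          rw [AddChar.map_neg_eq_inv, hx, inv_one] }
    have hH : H ≠ ⊤ := by
      intro h
      apply hψ0
      ext v
      have : v ∈ H := h ▸ AddSubgroup.mem_top v
      exact this
    have hbad : (s.filter (fun j => ψ (a i - a j) ∈ R)).card ≤ 2 * J * L := by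
      calc _ ≤ L * R.card := by
            refine Finset.card_le_mul_card_image_of_maps_to (f := fun j => ψ (a i - a j)) ?_ L ?_
            · intro j hj
              exact (Finset.mem_filter.1 hj).2
            · intro z _
              by_cases hne : ∃ j0, ψ (a i - a j0) = z
              · obtain ⟨j0, hj0⟩ := hne
                refine le_trans (Finset.card_le_card ?_) (hL H hH (a j0))
                intro j hj
                simp only [Finset.mem_filter] at hj ⊢
                refine ⟨hj.1.1, ?_⟩
                change ψ (a j - a j0) = 1
                have : a j - a j0 = (a i - a j0) - (a i - a j) := by abel
                rw [this, sub_eq_add_neg, AddChar.map_add_eq_mul, AddChar.map_neg_eq_inv, hj.2,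
                  hj0]
                refine mul_inv_cancel₀ ?_
                rw [← hj0]
                intro h0
                have := hnorm ψ (a i - a j0)
                rw [h0] at this
                simp at this
              · rw [Finset.card_eq_zero.2]
                · exact Nat.zero_le _
                · rw [Finset.filter_eq_empty_iff]
                  intro j _ h
                  exact hne ⟨j, h⟩
        _ ≤ L * (2 * J) := by gcongr
        _ = _ := by ring
    have hbad' : ((s.filter (fun j => ψ (a i - a j) ∈ R)).card : ℝ) ≤ M / 2 := by
      have h1 : ((s.filter (fun j => ψ (a i - a j) ∈ R)).card : ℝ) ≤ 2 * J * L := by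
        exact_mod_cast hbad
      have h2 : (4 * J * L : ℝ) ≤ M := by rw [hM]; exact_mod_cast hsL
      linarith
    have hpw : ∀ j ∈ s, ∑ k ∈ Finset.range K, (ψ (k • (a i - a j))).re ≤
        K / 2 + if ψ (a i - a j) ∈ R then (K / 2 : ℝ) else 0 := by
      intro j _
      split_ifs with h
      · refine (hpt _ _).trans ?_
        linarith
      · simp_rw [AddChar.map_nsmul_eq_pow]
        rw [add_zero]
        refine sum_range_re_pow_le ?_ hK (hnorm _ _)
        refine le_trans ?_ (hR _ (hchar _ _) h)
        rw [div_le_div_iff₀ hK' hp']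
        nlinarith
    refine (Finset.sum_le_sum hpw).trans ?_
    rw [Finset.sum_add_distrib, ← Finset.sum_filter]
    simp only [Finset.sum_const, nsmul_eq_mul]
    nlinarith
  by_contra! hcon
  set f : V → ℝ := fun g => ((Y.filter (fun y => y + g ∈ Y)).card : ℝ) with hf
  set y : ℝ := (Y.card : ℝ) with hy
  have hlow : ∀ i ∈ s, ∀ j ∈ s, ∀ k ∈ Finset.range K, 7 / 8 * y < f (k • (a i - a j)) := by
    intro i hi j hj k hk
    have h1 := hcon i hi j hj
    have h2 := card_filter_add_mem_add_shiftLoss Y (k • (a i - a j))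
    have h3 := shiftLoss_nsmul_le Y k (a i - a j)
    have h4 : k * shiftLoss Y (a i - a j) ≤ K * shiftLoss Y (a i - a j) := by
      gcongr
      exact (Finset.mem_range.1 hk).le
    have h5 : 7 * Y.card < 8 * (Y.filter (fun y => y + k • (a i - a j) ∈ Y)).card := by
      have : 8 * K * shiftLoss Y (a i - a j) = 8 * (K * shiftLoss Y (a i - a j)) := by ring
      omega
    have h6 : 7 * y < 8 * f (k • (a i - a j)) := by
      simp only [hy, hf]
      exact_mod_cast h5
    linarith
  obtain ⟨i, hi⟩ := hs
  have htot : M * K * (7 / 8 * y) < ∑ j ∈ s, ∑ k ∈ Finset.range K, f (k • (a i - a j)) := by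
    have e : M * K * (7 / 8 * y) = ∑ j ∈ s, ∑ k ∈ Finset.range K, (7 / 8 * y) := by
      simp [hM]; ring
    rw [e]
    refine Finset.sum_lt_sum_of_nonempty ⟨i, hi⟩ fun j hj => ?_
    exact Finset.sum_lt_sum_of_nonempty (Finset.nonempty_range_iff.2 hK.ne')
      fun k hk => hlow i hi j hj k hk
  have hexp : N * ∑ j ∈ s, ∑ k ∈ Finset.range K, f (k • (a i - a j)) =
      ∑ ψ : AddChar V ℂ, ‖∑ y ∈ Y, ψ y‖ ^ 2 *
        ∑ j ∈ s, ∑ k ∈ Finset.range K, (ψ (k • (a i - a j))).re := by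
    simp_rw [Finset.mul_sum]
    symm
    rw [Finset.sum_comm]
    refine Finset.sum_congr rfl fun j _ => ?_
    rw [Finset.sum_comm]
    exact Finset.sum_congr rfl fun k _ => (card_mul_card_filter_add_mem Y _).symm
  have hpars : N * y = ∑ ψ : AddChar V ℂ, ‖∑ y ∈ Y, ψ y‖ ^ 2 := by
    have := card_mul_card_filter_add_mem Y 0
    simpa using this
  have hub : N * ∑ j ∈ s, ∑ k ∈ Finset.range K, f (k • (a i - a j)) ≤
      3 / 4 * (M * K) * (N * y) + 1 / 4 * (M * K) * y ^ 2 := by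
    rw [hexp, hpars, Finset.mul_sum]
    have e : 1 / 4 * (M * K) * y ^ 2 =
        ∑ ψ : AddChar V ℂ, if ψ = 0 then 1 / 4 * (M * K) * y ^ 2 else 0 := by simp
    rw [e, ← Finset.sum_add_distrib]
    refine Finset.sum_le_sum fun ψ _ => ?_
    split_ifs with h0
    · subst h0
      have : ∑ j ∈ s, ∑ k ∈ Finset.range K, ((0 : AddChar V ℂ) (k • (a i - a j))).re = M * K := by
        simp [hM]
      rw [this]
      have : ‖∑ v ∈ Y, (0 : AddChar V ℂ) v‖ ^ 2 = y ^ 2 := by simp [hy]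
      rw [this]
      apply le_of_eq
      ring
    · rw [add_zero, mul_comm]
      gcongr
      exact hψ ψ h0 i
  have hY' : 2 * y ≤ N := by rw [hy, hN]; exact_mod_cast hY
  have hy0 : 0 ≤ y := by positivity
  have hMK : 0 < M * K := by positivity
  have h1 := mul_lt_mul_of_pos_left htot hN0
  have h2 : y ^ 2 ≤ N * y / 2 := by nlinarith
  have h3 := mul_le_mul_of_nonneg_left h2 hMK.le
  nlinarith

/-- Every element of `Y` is a sum of exactly `t` terms of the family `a` indexed by the set `s₀`
of at most `2 * t` indices. -/
def HasSubsums {V ι : Type*} [AddCommGroup V] (a : ι → V) (s₀ : Finset ι) (t : ℕ)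
    (Y : Finset V) : Prop :=
  s₀.card ≤ 2 * t ∧ ∀ v ∈ Y, ∃ u ⊆ s₀, u.card = t ∧ ∑ i ∈ u, a i = v

section HasSubsums

variable {V ι : Type*} [AddCommGroup V] {a : ι → V}

lemma hasSubsums_empty (a : ι → V) : HasSubsums a ∅ 0 {0} := by
  refine ⟨by simp, fun v hv => ⟨∅, by simp, by simp, ?_⟩⟩
  simp only [Finset.mem_singleton] at hv
  simp [hv]

lemma HasSubsums.exists_succ {s s₀ : Finset ι} {t : ℕ} {Y : Finset V} (h : HasSubsums a s₀ t Y)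
    (hs : s₀ ⊆ s) {i j : ι} (hi : i ∈ s \ s₀) (hj : j ∈ s \ s₀) :
    ∃ s₁ ⊆ s, ∃ Y₁, HasSubsums a s₁ (t + 1) Y₁ ∧
      Y.card + shiftLoss Y (a i - a j) ≤ Y₁.card := by
  rw [Finset.mem_sdiff] at hi hj
  refine ⟨insert i (insert j s₀), ?_, Y.image (· + a i) ∪ Y.image (· + a j), ⟨?_, ?_⟩, ?_⟩
  · intro x hx
    rcases Finset.mem_insert.1 hx with rfl | hx
    · exact hi.1
    · rcases Finset.mem_insert.1 hx with rfl | hx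
      · exact hj.1
      · exact hs hx
  · have h1 := Finset.card_insert_le i (insert j s₀)
    have h2 := Finset.card_insert_le j s₀
    have h3 := h.1
    omega
  · have aux : ∀ k, k ∉ s₀ → k ∈ insert i (insert j s₀) → ∀ y ∈ Y,
        ∃ u ⊆ insert i (insert j s₀), u.card = t + 1 ∧ ∑ i ∈ u, a i = y + a k := by
      intro k hk hk' y hy
      obtain ⟨u, hu, hc, hsum⟩ := h.2 y hy
      have hku : k ∉ u := fun h => hk (hu h)
      refine ⟨insert k u, ?_, ?_, ?_⟩
      · intro x hx
        rcases Finset.mem_insert.1 hx with rfl | hx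
        · exact hk'
        · exact Finset.mem_insert_of_mem (Finset.mem_insert_of_mem (hu hx))
      · rw [Finset.card_insert_of_notMem hku, hc]
      · rw [Finset.sum_insert hku, hsum, add_comm]
    intro v hv
    rcases Finset.mem_union.1 hv with hv | hv
    · obtain ⟨y, hy, rfl⟩ := Finset.mem_image.1 hv
      exact aux i hi.2 (by simp) y hy
    · obtain ⟨y, hy, rfl⟩ := Finset.mem_image.1 hv
      exact aux j hj.2 (by simp) y hy
  · have hd : Disjoint (Y.image (· + a j))
        ((Y.filter (fun y => y + (a i - a j) ∉ Y)).image (· + a i)) := by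
      rw [Finset.disjoint_left]
      intro v hv hv'
      obtain ⟨y, hy, rfl⟩ := Finset.mem_image.1 hv
      obtain ⟨z, hz, hzy⟩ := Finset.mem_image.1 hv'
      rw [Finset.mem_filter] at hz
      apply hz.2
      have : z + (a i - a j) = y := by
        have hzy' : z + a i = y + a j := hzy
        rw [← add_sub_assoc, hzy', add_sub_cancel_right]
      rwa [this]
    have h1 : (Y.image (· + a j)).card = Y.card :=
      Finset.card_image_of_injective _ (add_left_injective _)
    have h2 : ((Y.filter (fun y => y + (a i - a j) ∉ Y)).image (· + a i)).card =
        shiftLoss Y (a i - a j) :=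
      Finset.card_image_of_injective _ (add_left_injective _)
    rw [← h1, ← h2, ← Finset.card_union_of_disjoint hd]
    apply Finset.card_le_card
    intro v hv
    rcases Finset.mem_union.1 hv with hv | hv
    · exact Finset.mem_union_right _ hv
    · exact Finset.mem_union_left _
        (Finset.image_subset_image (Finset.filter_subset _ _) hv)

lemma exists_linearIndependent_sub {p d : ℕ} [Fact p.Prime] [Module (ZMod p) V] [Finite V]
    (hd : Module.finrank (ZMod p) V = d) {s : Finset ι} {L : ℕ}
    (hL : ∀ H : AddSubgroup V, H ≠ ⊤ → ∀ v, (s.filter (fun i => a i - v ∈ H)).card ≤ L)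
    (hs : L < s.card) :
    ∃ b : Fin d → V, LinearIndependent (ZMod p) b ∧ ∀ k, ∃ i ∈ s, ∃ j ∈ s, b k = a i - a j := by
  obtain ⟨i₀, hi₀⟩ : s.Nonempty := Finset.card_pos.1 (by omega)
  let D : Set V := (fun i => a i - a i₀) '' s
  have hspan : (⊤ : Submodule (ZMod p) V) ≤ Submodule.span (ZMod p) D := by
    by_contra hcon
    have hne : (Submodule.span (ZMod p) D).toAddSubgroup ≠ ⊤ := by
      intro h
      apply hcon
      intro v _
      have : v ∈ (Submodule.span (ZMod p) D).toAddSubgroup := h ▸ AddSubgroup.mem_top v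
      exact this
    have h1 := hL _ hne (a i₀)
    rw [Finset.filter_true_of_mem] at h1
    · omega
    · intro i hi
      exact Submodule.subset_span ⟨i, hi, rfl⟩
  let B := Module.Basis.ofSpan hspan
  have : Fintype ((linearIndepOn_empty (ZMod p) id).extend (Set.empty_subset D)) :=
    Fintype.ofFinite _
  have hcard := Module.finrank_eq_card_basis B
  rw [hd] at hcard
  let e := Fintype.equivFinOfCardEq hcard.symm
  refine ⟨B ∘ e.symm, B.linearIndependent.comp _ e.symm.injective, fun k => ?_⟩
  obtain ⟨i, hi, h⟩ := Module.Basis.ofSpan_subset hspan ⟨e.symm k, rfl⟩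
  exact ⟨i, hi, i₀, hi₀, h.symm⟩

lemma one_add_pow_le (d : ℕ) {x : ℝ} (h0 : 0 ≤ x) (h1 : x ≤ 1) :
    (1 + x) ^ d ≤ 1 + d * 2 ^ d * x := by
  induction d with
  | zero => simp
  | succ d ih =>
    rw [pow_succ]
    have h2 : (0 : ℝ) ≤ d * 2 ^ d := by positivity
    have h3 : (1 : ℝ) ≤ 2 ^ d := one_le_pow₀ (by norm_num)
    calc (1 + x) ^ d * (1 + x) ≤ (1 + d * 2 ^ d * x) * (1 + x) := by gcongr
      _ ≤ 1 + ((d + 1 : ℕ) : ℝ) * 2 ^ (d + 1) * x := by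
        push_cast
        rw [pow_succ]
        nlinarith [mul_nonneg h2 h0, mul_nonneg (mul_nonneg h2 h0) (sub_nonneg.2 h1)]

/-- The number of subset sums with `t` terms grows at least like `t ^ d`. -/
lemma exists_hasSubsums_pow_le {p d : ℕ} [Fact p.Prime] [Module (ZMod p) V] [Finite V]
    (hd : Module.finrank (ZMod p) V = d) (hd0 : 0 < d) {s : Finset ι} {L : ℕ}
    (hL : ∀ H : AddSubgroup V, H ≠ ⊤ → ∀ v, (s.filter (fun i => a i - v ∈ H)).card ≤ L)
    (hs : L + 2 * p < s.card) {t : ℕ} (ht : t ≤ p) :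
    ∃ s₀ ⊆ s, ∃ Y, HasSubsums a s₀ t Y ∧ 1 ≤ Y.card ∧
      ((t : ℝ) / (12 * d ^ 2 * 2 ^ d)) ^ d ≤ Y.card := by
  induction t with
  | zero =>
    refine ⟨∅, by simp, {0}, hasSubsums_empty a, by simp, ?_⟩
    simp [hd0.ne']
  | succ t ih =>
    obtain ⟨s₀, hs₀, Y, hY, hY1, hYt⟩ := ih (by omega)
    have hcard : L < (s \ s₀).card := by
      have h1 := Finset.le_card_sdiff s₀ s
      have h2 := hY.1
      omega
    set D : ℕ := 6 * d ^ 2 * 2 ^ d with hD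
    have hCD : (12 * d ^ 2 * 2 ^ d : ℝ) = 2 * D := by rw [hD]; push_cast; ring
    rw [hCD] at hYt ⊢
    have hD1 : 6 ≤ D := by
      have : 1 ≤ d ^ 2 * 2 ^ d := Nat.one_le_iff_ne_zero.2 (by positivity)
      rw [hD, mul_assoc]
      omega
    have hDR : (6 : ℝ) ≤ D := by exact_mod_cast hD1
    by_cases hbig : (((t + 1 : ℕ) : ℝ) / (2 * D)) ^ d ≤ Y.card
    · obtain ⟨i, hi⟩ : (s \ s₀).Nonempty := Finset.card_pos.1 (by omega)
      obtain ⟨s₁, hs₁, Y₁, hY₁, hc⟩ := hY.exists_succ hs₀ hi hi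
      refine ⟨s₁, hs₁, Y₁, hY₁, by omega, hbig.trans ?_⟩
      exact_mod_cast (Nat.le_add_right _ _).trans hc
    · push Not at hbig
      have htD : 2 * D ≤ t := by
        by_contra! hlt
        have h1 : ((t + 1 : ℕ) : ℝ) / (2 * D) ≤ 1 := by
          rw [div_le_one (by positivity)]
          exact_mod_cast hlt
        have h2 := pow_le_one₀ (n := d) (by positivity) h1
        have h3 : (1 : ℝ) ≤ Y.card := by exact_mod_cast hY1
        linarith
      have htR : (2 * D : ℝ) ≤ t := by exact_mod_cast htD
      set m : ℕ := (t + 1) / D + 1 with hm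
      have hm1 : (t + 1 : ℝ) / D ≤ m := by
        rw [div_le_iff₀ (by positivity)]
        have : t + 1 ≤ m * D := by
          have := Nat.lt_div_mul_add (a := t + 1) (b := D) (by omega)
          rw [hm, add_mul, one_mul]
          omega
        exact_mod_cast this
      have hm2 : (m : ℝ) * D ≤ 3 * t := by
        have : m * D ≤ t + 1 + D := by
          have := Nat.div_mul_le_self (t + 1) D
          rw [hm, add_mul, one_mul]
          omega
        have h2 : (m : ℝ) * D ≤ t + 1 + D := by exact_mod_cast this
        linarith
      have hmp : m ≤ p := by
        have h1 : (m : ℝ) * 6 ≤ 3 * t := le_trans (by gcongr) hm2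
        have h2 : (m : ℝ) ≤ t := by linarith
        have h3 : m ≤ t := by exact_mod_cast h2
        omega
      have hYm : 2 * Y.card ≤ m ^ d := by
        have h1 : (2 * Y.card : ℝ) ≤ (m : ℝ) ^ d := by
          calc (2 * Y.card : ℝ) ≤ 2 ^ d * (((t + 1 : ℕ) : ℝ) / (2 * D)) ^ d := by
                have : (2 : ℝ) ≤ 2 ^ d := by
                  calc (2 : ℝ) = 2 ^ 1 := by norm_num
                    _ ≤ 2 ^ d := pow_le_pow_right₀ (by norm_num) hd0
                gcongr
            _ = ((t + 1 : ℝ) / D) ^ d := by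
                rw [← mul_pow]
                congr 1
                push_cast
                field_simp
            _ ≤ (m : ℝ) ^ d := by gcongr
        exact_mod_cast h1
      obtain ⟨b, hb, hbs⟩ := exists_linearIndependent_sub (a := a) hd (s := s \ s₀) (L := L)
        (fun H hH v => le_trans (Finset.card_le_card
          (Finset.filter_subset_filter _ Finset.sdiff_subset)) (hL H hH v)) hcard
      obtain ⟨k, hk⟩ := exists_card_le_mul_shiftLoss_of_linearIndependent hb hd0
        (by rw [hm]; exact Nat.succ_pos _ : 1 ≤ m) hmp hYm
      obtain ⟨i, hi, j, hj, hij⟩ := hbs k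
      rw [hij] at hk
      obtain ⟨s₁, hs₁, Y₁, hY₁, hc⟩ := hY.exists_succ hs₀ hi hj
      refine ⟨s₁, hs₁, Y₁, hY₁, by omega, ?_⟩
      have hc' : (Y.card : ℝ) + shiftLoss Y (a i - a j) ≤ Y₁.card := by exact_mod_cast hc
      have hk' : (Y.card : ℝ) ≤ 2 * m * d * shiftLoss Y (a i - a j) := by exact_mod_cast hk
      have ht0 : (0 : ℝ) < t := by linarith
      have hd' : (0 : ℝ) < d := by exact_mod_cast hd0
      have hDval : (D : ℝ) = 6 * d ^ 2 * 2 ^ d := by rw [hD]; push_cast; ring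
      have hloss : (Y.card : ℝ) * (d * 2 ^ d * (1 / t)) ≤ shiftLoss Y (a i - a j) := by
        have h1 : 2 * (m : ℝ) * d * (d * 2 ^ d) ≤ t := by
          rw [hDval] at hm2
          nlinarith
        rw [mul_one_div, mul_div_assoc', div_le_iff₀ ht0]
        calc (Y.card : ℝ) * (d * 2 ^ d)
            ≤ 2 * m * d * shiftLoss Y (a i - a j) * (d * 2 ^ d) := by gcongr
          _ = shiftLoss Y (a i - a j) * (2 * (m : ℝ) * d * (d * 2 ^ d)) := by ring
          _ ≤ _ := by gcongr
      calc (((t + 1 : ℕ) : ℝ) / (2 * D)) ^ d = ((t : ℝ) / (2 * D)) ^ d * (1 + 1 / t) ^ d := by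
            rw [← mul_pow]
            congr 1
            push_cast
            field_simp
        _ ≤ Y.card * (1 + d * 2 ^ d * (1 / t)) := by
            gcongr
            refine one_add_pow_le d (by positivity) ?_
            rw [div_le_one ht0]
            linarith
        _ ≤ Y₁.card := by linarith

/-- Once a positive proportion of the group is covered by subset sums, few further terms suffice
to cover more than half of it. -/
lemma exists_hasSubsums_add {p : ℕ} [Fact p.Prime] [Fintype V] (hpV : ∀ v : V, p • v = 0)
    {s s₀ : Finset ι} {J K L t k : ℕ}
    (hL : ∀ H : AddSubgroup V, H ≠ ⊤ → ∀ v, (s.filter (fun i => a i - v ∈ H)).card ≤ L)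
    (hK : 0 < K) (hJK : p ≤ J * K) (hs : 4 * J * L + 2 * (t + k) < s.card) {θ : ℝ}
    {Y : Finset V} (hs₀ : s₀ ⊆ s) (hY : HasSubsums a s₀ t Y) (hθ : θ ≤ Y.card) :
    ∃ s₁ ⊆ s, ∃ Y₁, HasSubsums a s₁ (t + k) Y₁ ∧
      (Fintype.card V < 2 * Y₁.card ∨ θ * (1 + k / (8 * K)) ≤ Y₁.card) := by
  suffices h : ∃ s₁ ⊆ s, ∃ Y₁, HasSubsums a s₁ (t + k) Y₁ ∧ θ ≤ Y₁.card ∧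
      (Fintype.card V < 2 * Y₁.card ∨ θ * (1 + k / (8 * K)) ≤ Y₁.card) by
    obtain ⟨s₁, hs₁, Y₁, h1, -, h2⟩ := h
    exact ⟨s₁, hs₁, Y₁, h1, h2⟩
  induction k with
  | zero => exact ⟨s₀, hs₀, Y, hY, hθ, Or.inr (by simpa using hθ)⟩
  | succ k ih =>
    obtain ⟨s₁, hs₁, Y₁, hY₁, hθ₁, h⟩ := ih (by omega)
    have hcard : 4 * J * L < (s \ s₁).card := by
      have h1 := Finset.le_card_sdiff s₁ s
      have h2 := hY₁.1
      omega
    have hne : (s \ s₁).Nonempty := Finset.card_pos.1 (by omega)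
    by_cases hbig : Fintype.card V < 2 * Y₁.card
    · obtain ⟨i, hi⟩ := hne
      obtain ⟨s₂, hs₂, Y₂, hY₂, hc⟩ := hY₁.exists_succ hs₁ hi hi
      refine ⟨s₂, hs₂, Y₂, hY₂, hθ₁.trans ?_, Or.inl (by omega)⟩
      exact_mod_cast (Nat.le_add_right _ _).trans hc
    · obtain ⟨i, hi, j, hj, hij⟩ := exists_card_le_mul_shiftLoss_sub hpV (a := a) hne
        (fun H hH v => le_trans (Finset.card_le_card
          (Finset.filter_subset_filter _ Finset.sdiff_subset)) (hL H hH v))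
        hcard.le hK hJK (Y := Y₁) (by omega)
      obtain ⟨s₂, hs₂, Y₂, hY₂, hc⟩ := hY₁.exists_succ hs₁ hi hj
      have hc' : (Y₁.card : ℝ) + shiftLoss Y₁ (a i - a j) ≤ Y₂.card := by exact_mod_cast hc
      have hij' : (Y₁.card : ℝ) ≤ 8 * K * shiftLoss Y₁ (a i - a j) := by exact_mod_cast hij
      have hK' : (0 : ℝ) < K := by exact_mod_cast hK
      have hl0 : (0 : ℝ) ≤ shiftLoss Y₁ (a i - a j) := by positivity
      refine ⟨s₂, hs₂, Y₂, hY₂, by linarith, Or.inr ?_⟩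
      rcases h with h | h
      · exact absurd h hbig
      · have h1 : θ / (8 * K) ≤ shiftLoss Y₁ (a i - a j) := by
          rw [div_le_iff₀ (by positivity)]
          linarith
        calc θ * (1 + ((k + 1 : ℕ) : ℝ) / (8 * K)) =
            θ * (1 + (k : ℝ) / (8 * K)) + θ / (8 * K) := by push_cast; ring
          _ ≤ _ := by linarith

lemma exists_hasSubsums_half {p d : ℕ} [Fact p.Prime] [Module (ZMod p) V] [Fintype V]
    (hd : Module.finrank (ZMod p) V = d) (hd0 : 0 < d) {s : Finset ι} {J L t : ℕ}
    (hJ : J = 64 * (8 * (12 * d ^ 2 * 2 ^ d)) ^ d) (hJp : J ≤ p)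
    (hL : ∀ H : AddSubgroup V, H ≠ ⊤ → ∀ v, (s.filter (fun i => a i - v ∈ H)).card ≤ L)
    (hs : 4 * J * L + 2 * p < s.card) (ht : p / 2 ≤ t) (htp : t ≤ p) :
    ∃ s₀ ⊆ s, ∃ Y, HasSubsums a s₀ t Y ∧ Fintype.card V < 2 * Y.card := by
  set C : ℕ := 12 * d ^ 2 * 2 ^ d with hC
  have hC0 : 0 < C := by positivity
  have hJ64 : 64 ≤ J := by
    have : 1 ≤ (8 * C) ^ d := Nat.one_le_iff_ne_zero.2 (by positivity)
    omega
  have hpV : ∀ v : V, p • v = 0 := fun v => by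
    rw [← Nat.cast_smul_eq_nsmul (ZMod p), CharP.cast_eq_zero, zero_smul]
  have hLJ : L ≤ 4 * J * L := Nat.le_mul_of_pos_left _ (by omega)
  set t₁ : ℕ := p / 8 + 1
  obtain ⟨s₀, hs₀, Y, hY, -, hYc⟩ := exists_hasSubsums_pow_le (a := a) hd hd0 hL
    (by omega) (t := t₁) (by omega)
  set θ : ℝ := ((p : ℝ) / (8 * C)) ^ d with hθ
  have ht₁ : (p : ℝ) / 8 ≤ t₁ := by
    rw [div_le_iff₀ (by norm_num)]
    have : p ≤ t₁ * 8 := by omega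
    exact_mod_cast this
  have hθY : θ ≤ Y.card := by
    refine le_trans ?_ hYc
    rw [hθ]
    have : (12 * d ^ 2 * 2 ^ d : ℝ) = C := by rw [hC]; push_cast; ring
    rw [this, ← div_div]
    gcongr
  obtain ⟨k, rfl⟩ : ∃ k, t = t₁ + k := ⟨t - t₁, by omega⟩
  have hK : p ≤ J * (p / J + 1) := by
    have := Nat.div_add_mod p J
    have := Nat.mod_lt p (show 0 < J by omega)
    rw [mul_add]
    omega
  obtain ⟨s₁, hs₁, Y₁, hY₁, h⟩ := exists_hasSubsums_add hpV hL (K := p / J + 1) (k := k)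
    (Nat.succ_pos _) hK (by omega) hs₀ hY hθY
  refine ⟨s₁, hs₁, Y₁, hY₁, ?_⟩
  rcases h with h | h
  · exact h
  · have hN : (Fintype.card V : ℝ) = (p : ℝ) ^ d := by
      rw [Module.card_eq_pow_finrank (K := ZMod p), hd, ZMod.card]
      push_cast
      rfl
    have hk : (p : ℝ) / 8 ≤ k := by
      rw [div_le_iff₀ (by norm_num)]
      have : p ≤ k * 8 := by omega
      exact_mod_cast this
    have hJ0 : (0 : ℝ) < J := by exact_mod_cast (by omega : 0 < J)
    have hp0 : (0 : ℝ) < p := by exact_mod_cast (by omega : 0 < p)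
    have hKle : ((p / J + 1 : ℕ) : ℝ) ≤ 2 * p / J := by
      rw [le_div_iff₀ hJ0]
      have h1 := Nat.div_mul_le_self p J
      have : (p / J + 1) * J ≤ 2 * p := by rw [add_mul]; omega
      exact_mod_cast this
    have hfrac : (J : ℝ) / 128 ≤ k / (8 * ((p / J + 1 : ℕ) : ℝ)) := by
      rw [div_le_div_iff₀ (by norm_num) (by positivity)]
      rw [le_div_iff₀ hJ0] at hKle
      nlinarith
    have hJR : (J : ℝ) = 64 * (8 * C) ^ d := by rw [hJ]; push_cast; ring
    have hθJ : θ * (J / 128) = (p : ℝ) ^ d / 2 := by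
      rw [hθ, hJR, div_pow]
      field_simp
      norm_num
    have hθ0 : 0 < θ := by positivity
    have h2 : (Fintype.card V : ℝ) < 2 * Y₁.card := by
      rw [hN]
      have := mul_le_mul_of_nonneg_left hfrac hθ0.le
      nlinarith
    exact_mod_cast h2

end HasSubsums

lemma exists_sum_eq_zero_of_card_mul_le {p : ℕ} {V ι : Type*} [AddCommGroup V] [Fintype V]
    (hpV : ∀ v : V, p • v = 0) (a : ι → V) (s : Finset ι) (hs : Fintype.card V * p ≤ s.card) :
    ∃ u ⊆ s, u.card = p ∧ ∑ i ∈ u, a i = 0 := by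
  obtain ⟨v, -, hv⟩ := Finset.exists_le_card_fiber_of_mul_le_card_of_maps_to
    (s := s) (t := Finset.univ) (f := a) (n := p) (fun _ _ => Finset.mem_univ _)
    Finset.univ_nonempty (by simpa using hs)
  obtain ⟨u, hu, hc⟩ := Finset.exists_subset_card_eq hv
  refine ⟨u, hu.trans (Finset.filter_subset _ _), hc, ?_⟩
  rw [Finset.sum_congr rfl (fun i hi => (Finset.mem_filter.1 (hu hi)).2)]
  simp [hc, hpV]

lemma exists_sum_eq_zero_of_not_concentrated {p d : ℕ} [Fact p.Prime] {V ι : Type*}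
    [AddCommGroup V] [Module (ZMod p) V] [Fintype V]
    (hd : Module.finrank (ZMod p) V = d) (hd0 : 0 < d) {a : ι → V} {s : Finset ι} {J L : ℕ}
    (hJ : J = 64 * (8 * (12 * d ^ 2 * 2 ^ d)) ^ d) (hJp : J ≤ p)
    (hL : ∀ H : AddSubgroup V, H ≠ ⊤ → ∀ v, (s.filter (fun i => a i - v ∈ H)).card ≤ L)
    (hs : 4 * J * L + 4 * p < s.card) :
    ∃ u ⊆ s, u.card = p ∧ ∑ i ∈ u, a i = 0 := by
  obtain ⟨s₁, hs₁, Y₁, hY₁, h₁⟩ := exists_hasSubsums_half (a := a) (t := p / 2) hd hd0 hJ hJp hL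
    (by omega) le_rfl (by omega)
  obtain ⟨s₂, hs₂, Y₂, hY₂, h₂⟩ := exists_hasSubsums_half (a := a) (s := s \ s₁)
    (t := p - p / 2) hd hd0 hJ hJp
    (fun H hH v => le_trans (Finset.card_le_card
      (Finset.filter_subset_filter _ Finset.sdiff_subset)) (hL H hH v))
    (by
      have := Finset.le_card_sdiff s₁ s
      have := hY₁.1
      omega) (by omega) (by omega)
  obtain ⟨v, hv₁, hv₂⟩ : ∃ v, v ∈ Y₁.image (fun y => -y) ∧ v ∈ Y₂ := by
    by_contra! hcon
    have hdis : Disjoint (Y₁.image (fun y => -y)) Y₂ := Finset.disjoint_left.2 hcon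
    have h3 := Finset.card_le_univ (Y₁.image (fun y => -y) ∪ Y₂)
    rw [Finset.card_union_of_disjoint hdis, Finset.card_image_of_injective _ neg_injective] at h3
    omega
  obtain ⟨y, hy, rfl⟩ := Finset.mem_image.1 hv₁
  obtain ⟨u₁, hu₁, hc₁, hsum₁⟩ := hY₁.2 y hy
  obtain ⟨u₂, hu₂, hc₂, hsum₂⟩ := hY₂.2 _ hv₂
  have hdis : Disjoint u₁ u₂ := by
    rw [Finset.disjoint_left]
    intro i hi hi'
    exact (Finset.mem_sdiff.1 (hs₂ (hu₂ hi'))).2 (hu₁ hi)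
  refine ⟨u₁ ∪ u₂, Finset.union_subset (hu₁.trans hs₁)
    (hu₂.trans (hs₂.trans Finset.sdiff_subset)), ?_, ?_⟩
  · rw [Finset.card_union_of_disjoint hdis]
    omega
  · rw [Finset.sum_union hdis, hsum₁, hsum₂, add_neg_cancel]

/-- **Alon–Dubiner**: linearly many elements of a vector space of bounded dimension over `ZMod p`
contain `p` elements with sum zero. -/
theorem exists_const_sum_eq_zero (r : ℕ) :
    ∃ c : ℕ, 0 < c ∧ ∀ (p : ℕ) [Fact p.Prime] (V ι : Type) [AddCommGroup V] [Module (ZMod p) V]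
      [Finite V], Module.finrank (ZMod p) V ≤ r → ∀ (a : ι → V) (s : Finset ι),
      c * p ≤ s.card → ∃ u ⊆ s, u.card = p ∧ ∑ i ∈ u, a i = 0 := by
  induction r with
  | zero =>
    refine ⟨1, one_pos, fun p _ V ι _ _ _ hr a s hs => ?_⟩
    have : Subsingleton V := Module.finrank_zero_iff.1 (Nat.le_zero.1 hr)
    obtain ⟨u, hu, hc⟩ := Finset.exists_subset_card_eq (s := s) (n := p) (by omega)
    exact ⟨u, hu, hc, Subsingleton.elim _ _⟩
  | succ r ih =>
    obtain ⟨c, hc, h⟩ := ih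
    set d := r + 1 with hd
    set J : ℕ := 64 * (8 * (12 * d ^ 2 * 2 ^ d)) ^ d with hJ
    refine ⟨4 * J * c + 5 + J ^ d + c, by omega, fun p _ V ι _ _ _ hr a s hs => ?_⟩
    have hp : 0 < p := (Fact.out : p.Prime).pos
    have hexp : (4 * J * c + 5 + J ^ d + c) * p = 4 * J * (c * p) + 5 * p + J ^ d * p + c * p := by
      ring
    rw [hexp] at hs
    have : Fintype V := Fintype.ofFinite V
    have hpV : ∀ v : V, p • v = 0 := fun v => by
      rw [← Nat.cast_smul_eq_nsmul (ZMod p), CharP.cast_eq_zero, zero_smul]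
    by_cases hrr : Module.finrank (ZMod p) V ≤ r
    · exact h p V ι hrr a s (by omega)
    have hrd : Module.finrank (ZMod p) V = d := by omega
    by_cases hpJ : p < J
    · refine exists_sum_eq_zero_of_card_mul_le hpV a s ?_
      rw [Module.card_eq_pow_finrank (K := ZMod p), hrd, ZMod.card]
      have : p ^ d * p ≤ J ^ d * p := by gcongr
      omega
    · push Not at hpJ
      by_cases hcon : ∀ H : AddSubgroup V, H ≠ ⊤ → ∀ v,
          (s.filter (fun i => a i - v ∈ H)).card ≤ c * p
      · exact exists_sum_eq_zero_of_not_concentrated hrd (by omega) hJ hpJ hcon (by omega)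
      · push Not at hcon
        obtain ⟨H, hH, v, hHv⟩ := hcon
        let H' : Submodule (ZMod p) V := AddSubgroup.toZModSubmodule p H
        have hH' : H' < ⊤ := by
          rw [lt_top_iff_ne_top]
          intro h
          apply hH
          ext x
          have : x ∈ H' := h ▸ Submodule.mem_top
          simpa [H'] using this
        have hfr : Module.finrank (ZMod p) H' ≤ r := by
          have := Submodule.finrank_lt hH'.ne
          omega
        let a' : ι → H' := fun i => if hi : a i - v ∈ H then ⟨a i - v, hi⟩ else 0
        obtain ⟨u, hu, huc, hsum⟩ := h p H' ι hfr a' _ hHv.le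
        refine ⟨u, hu.trans (Finset.filter_subset _ _), huc, ?_⟩
        have h1 : ∑ i ∈ u, (a i - v) = 0 := by
          have h2 := congrArg (H'.subtype) hsum
          rw [map_sum, map_zero] at h2
          rw [← h2]
          refine Finset.sum_congr rfl fun i hi => ?_
          have := (Finset.mem_filter.1 (hu hi)).2
          simp [a', this]
        rw [Finset.sum_sub_distrib, Finset.sum_const, huc, hpV, sub_zero] at h1
        exact h1

theorem exists_nonempty_sum_eq_zero (p : ℕ) [Fact p.Prime] {V : Type} [AddCommGroup V]
    [Module (ZMod p) V] [Finite V] {N : ℕ} (a : Fin N → V)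
    (hN : Module.finrank (ZMod p) V * (p - 1) < N) :
    ∃ u : Finset (Fin N), u.Nonempty ∧ ∑ i ∈ u, a i = 0 := by
  classical
  have hp : p.Prime := Fact.out
  let b := Module.finBasis (ZMod p) V
  let f : Fin (Module.finrank (ZMod p) V) → MvPolynomial (Fin N) (ZMod p) := fun k =>
    ∑ i, MvPolynomial.C (b.repr (a i) k) * MvPolynomial.X i ^ (p - 1)
  have hdeg : ∑ k, (f k).totalDegree < Fintype.card (Fin N) := by
    rw [Fintype.card_fin]
    refine lt_of_le_of_lt ?_ hN
    calc ∑ k, (f k).totalDegree ≤ ∑ _k : Fin (Module.finrank (ZMod p) V), (p - 1) := by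
          refine Finset.sum_le_sum fun k _ => ?_
          refine MvPolynomial.totalDegree_finsetSum_le fun i _ => ?_
          refine (MvPolynomial.totalDegree_mul _ _).trans ?_
          simp
      _ = _ := by simp
  have hcard : ∀ (α : Type) (_ : Fintype α), p ∣ Fintype.card α → p ∣ Nat.card α :=
    fun α _ h => by rwa [Nat.card_eq_fintype_card]
  have hdvd := hcard _ _
    (char_dvd_card_solutions_of_sum_lt (K := ZMod p) p (s := Finset.univ) (f := f) hdeg)
  have hzero : ∀ k ∈ Finset.univ, MvPolynomial.eval (0 : Fin N → ZMod p) (f k) = 0 := by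
    intro k _
    have : p - 1 ≠ 0 := Nat.sub_ne_zero_of_lt hp.one_lt
    simp [f, this]
  have hlt := hp.one_lt.trans_le (Nat.le_of_dvd (@Nat.card_pos _ ⟨⟨0, hzero⟩⟩ _) hdvd)
  have hnt := Finite.one_lt_card_iff_nontrivial.mp hlt
  obtain ⟨⟨x, hx⟩, hne⟩ := exists_ne
    (⟨0, hzero⟩ : {x : Fin N → ZMod p // ∀ k ∈ Finset.univ, MvPolynomial.eval x (f k) = 0})
  have hx0 : x ≠ 0 := fun h => hne (Subtype.ext h)
  obtain ⟨j, hj⟩ := Function.ne_iff.mp hx0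
  refine ⟨Finset.univ.filter fun i => x i ≠ 0, ⟨j, by simpa using hj⟩, ?_⟩
  refine b.repr.injective (Finsupp.ext fun k => ?_)
  have hk := hx k (Finset.mem_univ k)
  simp only [f, map_sum, map_mul, MvPolynomial.eval_C, map_pow, MvPolynomial.eval_X] at hk
  rw [map_sum, Finsupp.finsetSum_apply, Finset.sum_filter, map_zero, Finsupp.zero_apply]
  refine Eq.trans (Finset.sum_congr rfl fun i _ => ?_) hk
  split_ifs with h
  · rw [ZMod.pow_card_sub_one_eq_one h, mul_one]
  · have : p - 1 ≠ 0 := Nat.sub_ne_zero_of_lt hp.one_lt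
    simp [not_not.mp h, this]

theorem Multiset.exists_eq_map_univ {G : Type*} (S : Multiset G) :
    ∃ a : Fin (Multiset.card S) → G,
      S = (Finset.univ : Finset (Fin (Multiset.card S))).val.map a := by
  induction S using Quotient.inductionOn with | _ l
  exact ⟨l.get, (congrArg _ (List.ofFn_get l).symm).trans (Fin.univ_val_map l.get).symm⟩

theorem card_ker_nsmul_le (r n p : ℕ) [NeZero n] (hp : 0 < p) :
    Nat.card (nsmulAddMonoidHom p : (Fin r → ZMod n) →+ (Fin r → ZMod n)).ker ≤ p ^ r := by
  classical
  let φ : (nsmulAddMonoidHom p : (Fin r → ZMod n) →+ (Fin r → ZMod n)).ker →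
      (Fin r → (Finset.univ.filter fun x : ZMod n => p • x = 0)) := fun g i =>
    ⟨g.1 i, by
      have := congrFun g.2 i
      simpa using this⟩
  have hφ : Function.Injective φ := fun g h hgh => by
    refine Subtype.ext (funext fun i => ?_)
    exact congrArg Subtype.val (congrFun hgh i)
  refine (Nat.card_le_card_of_injective φ hφ).trans ?_
  rw [Nat.card_fun, Nat.card_fin, Nat.card_eq_fintype_card, Fintype.card_coe]
  exact Nat.pow_le_pow_left (IsAddCyclic.card_nsmul_eq_zero_le hp) r

theorem finrank_ker_nsmul_le (r n p : ℕ) [NeZero n] [Fact p.Prime]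
    [Module (ZMod p) (nsmulAddMonoidHom p : (Fin r → ZMod n) →+ (Fin r → ZMod n)).ker] :
    Module.finrank (ZMod p)
      (nsmulAddMonoidHom p : (Fin r → ZMod n) →+ (Fin r → ZMod n)).ker ≤ r := by
  have hp : p.Prime := Fact.out
  have h := card_ker_nsmul_le r n p hp.pos
  rw [Module.natCard_eq_pow_finrank (K := ZMod p), Nat.card_zmod] at h
  exact (Nat.pow_le_pow_iff_right hp.one_lt).mp h

/-- An elementary version of Olson's bound for the `p`-torsion of `C_n ^ r`. -/
theorem card_le_of_isZeroSumFree_of_nsmul_eq_zero {r n p : ℕ} [NeZero n] (hp : p.Prime)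
    {S : Multiset (Fin r → ZMod n)} (hS : IsZeroSumFree S) (hT : ∀ g ∈ S, p • g = 0) :
    Multiset.card S ≤ r * (p - 1) := by
  have : Fact p.Prime := ⟨hp⟩
  let H := (nsmulAddMonoidHom p : (Fin r → ZMod n) →+ (Fin r → ZMod n)).ker
  let _ : Module (ZMod p) H := AddCommGroup.zmodModule fun x => Subtype.ext x.2
  obtain ⟨a, ha⟩ := S.exists_eq_map_univ
  have hmem : ∀ i, a i ∈ H := fun i => hT _ (by
    rw [ha]; exact Multiset.mem_map_of_mem a (Finset.mem_univ i))
  by_contra! hlt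
  obtain ⟨u, hu, hsum⟩ := exists_nonempty_sum_eq_zero p (fun i => (⟨a i, hmem i⟩ : H))
    (lt_of_le_of_lt (Nat.mul_le_mul_right _ (finrank_ker_nsmul_le r n p)) hlt)
  refine hS (u.val.map a) ?_ ?_ ?_
  · conv_rhs => rw [ha]
    exact Multiset.map_le_map (Finset.val_le_iff.mpr (Finset.subset_univ u))
  · simpa using hu.ne_empty
  · simpa using congrArg Subtype.val hsum

theorem exists_const_submultiset (r : ℕ) : ∃ c : ℕ, 0 < c ∧ ∀ (n p : ℕ) [NeZero n], p.Prime →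
    ∀ (f : (Fin r → ZMod n) →+ (Fin r → ZMod n)) (S : Multiset (Fin r → ZMod n)),
      (∀ g ∈ S, p • f g = 0) → c * p ≤ Multiset.card S →
      ∃ T ≤ S, Multiset.card T = p ∧ f T.sum = 0 := by
  obtain ⟨c, hc, h⟩ := exists_const_sum_eq_zero r
  refine ⟨c, hc, fun n p _ hp f S hS hcard => ?_⟩
  have : Fact p.Prime := ⟨hp⟩
  let H := (nsmulAddMonoidHom p : (Fin r → ZMod n) →+ (Fin r → ZMod n)).ker
  let _ : Module (ZMod p) H := AddCommGroup.zmodModule fun x => Subtype.ext x.2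
  obtain ⟨a, ha⟩ := S.exists_eq_map_univ
  have hmem : ∀ i, f (a i) ∈ H := fun i => hS _ (by
    rw [ha]; exact Multiset.mem_map_of_mem a (Finset.mem_univ i))
  obtain ⟨u, -, hu, hsum⟩ := h p H (Fin (Multiset.card S)) (finrank_ker_nsmul_le r n p)
    (fun i => ⟨f (a i), hmem i⟩) Finset.univ (by simpa using hcard)
  refine ⟨u.val.map a, ?_, by simpa using hu, ?_⟩
  · conv_rhs => rw [ha]
    exact Multiset.map_le_map (Finset.val_le_iff.mpr (Finset.subset_univ u))
  · have := congrArg Subtype.val hsum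
    rw [← Finset.sum, map_sum]
    simpa using this

theorem crossNumber_cons {G : Type*} [AddCommGroup G] (g : G) (S : Multiset G) :
    crossNumber (g ::ₘ S) = (1 : ℝ) / addOrderOf g + crossNumber S := by
  simp [crossNumber]

theorem crossNumber_add {G : Type*} [AddCommGroup G] (S T : Multiset G) :
    crossNumber (S + T) = crossNumber S + crossNumber T := by
  simp [crossNumber]

theorem crossNumber_of_addOrderOf_eq {G : Type*} [AddCommGroup G] {S : Multiset G} {d : ℕ}
    (h : ∀ g ∈ S, addOrderOf g = d) : crossNumber S = Multiset.card S / (d : ℝ) := by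
  unfold crossNumber
  rw [Multiset.map_congr rfl fun g hg => by rw [h g hg], Multiset.map_const',
    Multiset.sum_replicate, nsmul_eq_mul, mul_one_div]

theorem crossNumber_eq_sum {G : Type*} [AddCommGroup G] (D : Finset ℕ) (S : Multiset G)
    (h : ∀ g ∈ S, addOrderOf g ∈ D) :
    crossNumber S = ∑ d ∈ D, (S.countP (fun g => addOrderOf g = d) : ℝ) / d := by
  induction S using Multiset.induction_on with
  | empty => simp [crossNumber]
  | cons g S ih =>
    rw [crossNumber_cons, ih fun x hx => h x (Multiset.mem_cons_of_mem hx)]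
    simp only [Multiset.countP_cons, Nat.cast_add, add_div, Finset.sum_add_distrib]
    rw [add_comm]
    congr 1
    rw [Finset.sum_eq_single_of_mem _ (h g (Multiset.mem_cons_self g S))]
    · simp
    · intro d _ hd
      simp [hd.symm]

theorem IsZeroSumFree.mono {G : Type*} [AddCommGroup G] {S T : Multiset G}
    (hS : IsZeroSumFree S) (h : T ≤ S) : IsZeroSumFree T :=
  fun U hU hU0 => hS U (hU.trans h) hU0

theorem IsZeroSumFree.sum_cons {G : Type*} [AddCommGroup G] {T R : Multiset G}
    (hS : IsZeroSumFree (T + R)) (hT0 : T ≠ 0) : IsZeroSumFree (T.sum ::ₘ R) := by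
  intro U hU hU0
  by_cases ha : T.sum ∈ U
  · obtain ⟨W, rfl⟩ := Multiset.exists_cons_of_mem ha
    rw [Multiset.sum_cons, ← Multiset.sum_add]
    exact hS _ (add_le_add_right ((Multiset.cons_le_cons_iff _).mp hU) T)
      fun h => hT0 (add_eq_zero.mp h).1
  · exact hS U (((Multiset.le_cons_of_notMem ha).mp hU).trans (Multiset.le_add_left R T)) hU0

theorem nsmul_pi_zmod_eq_zero {r n : ℕ} (g : Fin r → ZMod n) : n • g = 0 := by
  ext i
  simp

theorem addOrderOf_pi_zmod_mem_divisors {r n : ℕ} [NeZero n] (g : Fin r → ZMod n) :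
    addOrderOf g ∈ n.divisors :=
  Nat.mem_divisors.mpr ⟨addOrderOf_dvd_of_nsmul_eq_zero (nsmul_pi_zmod_eq_zero g), NeZero.ne n⟩

theorem countP_addOrderOf_prime_le {r n p : ℕ} [NeZero n] (hp : p.Prime)
    {S : Multiset (Fin r → ZMod n)} (hS : IsZeroSumFree S) :
    S.countP (fun g => addOrderOf g = p) ≤ r * (p - 1) := by
  rw [Multiset.countP_eq_card_filter]
  refine card_le_of_isZeroSumFree_of_nsmul_eq_zero hp (hS.mono (Multiset.filter_le _ S)) ?_
  intro g hg
  rw [← (Multiset.mem_filter.mp hg).2]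
  exact addOrderOf_nsmul_eq_zero g

theorem IsZeroSumFree.countP_addOrderOf_one {G : Type*} [AddCommGroup G] {S : Multiset G}
    (hS : IsZeroSumFree S) : S.countP (fun g => addOrderOf g = 1) = 0 := by
  rw [Multiset.countP_eq_zero]
  intro g hg h1
  rw [AddMonoid.addOrderOf_eq_one_iff] at h1
  exact hS {g} (Multiset.singleton_le.mpr hg) (Multiset.singleton_ne_zero g) (by simpa using h1)

theorem crossNumber_le_of_countP_le {r n c : ℕ} [NeZero n] {S : Multiset (Fin r → ZMod n)}
    (hS : IsZeroSumFree S)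
    (h : ∀ d ∈ n.divisors, d ≠ 1 → ¬ d.Prime →
      S.countP (fun g => addOrderOf g = d) ≤ c * d.minFac) :
    crossNumber S ≤ r * n.primeFactors.card +
      c * (tailEulerSum n.primeFactors - n.primeFactors.card) := by
  rw [crossNumber_eq_sum n.divisors S fun g _ => addOrderOf_pi_zmod_mem_divisors g,
    ← Finset.sum_filter_add_sum_filter_not n.divisors fun d => d ≠ 1 ∧ ¬ d.Prime, add_comm]
  have hcomp : ∑ d ∈ n.divisors.filter (fun d => d ≠ 1 ∧ ¬ d.Prime),
      (S.countP (fun g => addOrderOf g = d) : ℝ) / d ≤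
      c * (tailEulerSum n.primeFactors - n.primeFactors.card) := by
    refine le_trans ?_ (mul_le_mul_of_nonneg_left (sum_minFac_div_le (NeZero.ne n))
      (Nat.cast_nonneg c))
    rw [Finset.mul_sum]
    refine Finset.sum_le_sum fun d hd => ?_
    obtain ⟨hd, h1, hp⟩ := Finset.mem_filter.mp hd
    rw [← mul_div_assoc]
    refine div_le_div_of_nonneg_right ?_ (Nat.cast_nonneg d)
    exact_mod_cast h d hd h1 hp
  have hprime : ∑ d ∈ n.divisors.filter (fun d => ¬ (d ≠ 1 ∧ ¬ d.Prime)),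
      (S.countP (fun g => addOrderOf g = d) : ℝ) / d ≤ r * n.primeFactors.card := by
    have hsub : n.primeFactors ⊆ n.divisors.filter (fun d => ¬ (d ≠ 1 ∧ ¬ d.Prime)) := by
      intro p hp
      refine Finset.mem_filter.mpr ⟨Nat.mem_divisors.mpr
        ⟨Nat.dvd_of_mem_primeFactors hp, NeZero.ne n⟩, fun h => ?_⟩
      exact h.2 (Nat.prime_of_mem_primeFactors hp)
    rw [← Finset.sum_subset hsub]
    · calc ∑ p ∈ n.primeFactors, (S.countP (fun g => addOrderOf g = p) : ℝ) / p
          ≤ ∑ _p ∈ n.primeFactors, (r : ℝ) := by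
            refine Finset.sum_le_sum fun p hp => ?_
            have hpp := Nat.prime_of_mem_primeFactors hp
            rw [div_le_iff₀ (by exact_mod_cast hpp.pos)]
            exact_mod_cast (countP_addOrderOf_prime_le hpp hS).trans
              (Nat.mul_le_mul_left r (Nat.sub_le p 1))
        _ = r * n.primeFactors.card := by
            rw [Finset.sum_const, nsmul_eq_mul, mul_comm]
    · intro d hd hdn
      have hd1 : d = 1 := by
        by_contra h1
        obtain ⟨hdn', hd'⟩ := Finset.mem_filter.mp hd
        have hp : d.Prime := by tauto
        exact hdn (Nat.mem_primeFactors.mpr ⟨hp, Nat.dvd_of_mem_divisors hdn', NeZero.ne n⟩)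
      subst hd1
      rw [hS.countP_addOrderOf_one]
      simp
  linarith

theorem exists_const_crossNumber_le (r : ℕ) : ∃ c : ℕ, ∀ (n : ℕ) [NeZero n]
    (S : Multiset (Fin r → ZMod n)), IsZeroSumFree S →
    crossNumber S ≤ r * n.primeFactors.card +
      c * (tailEulerSum n.primeFactors - n.primeFactors.card) := by
  obtain ⟨c, -, hsub⟩ := exists_const_submultiset r
  refine ⟨c, fun n _ S hS => ?_⟩
  induction hk : Multiset.card S using Nat.strong_induction_on generalizing S with
  | _ k ih =>
  by_cases hcount : ∀ d ∈ n.divisors, d ≠ 1 → ¬ d.Prime →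
      S.countP (fun g => addOrderOf g = d) ≤ c * d.minFac
  · exact crossNumber_le_of_countP_le hS hcount
  push Not at hcount
  obtain ⟨d, hd, h1, -, hlt⟩ := hcount
  have hp := Nat.minFac_prime h1
  have hd0 : 0 < d := Nat.pos_of_mem_divisors hd
  have hpd := Nat.minFac_dvd d
  obtain ⟨T, hT, hTcard, hTsum⟩ := hsub n d.minFac hp (nsmulAddMonoidHom (d / d.minFac))
    (S.filter fun g => addOrderOf g = d)
    (fun g hg => by
      rw [nsmulAddMonoidHom_apply, ← mul_nsmul', Nat.mul_div_cancel' hpd,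
        ← (Multiset.mem_filter.mp hg).2]
      exact addOrderOf_nsmul_eq_zero g)
    (by rw [← Multiset.countP_eq_card_filter]; exact hlt.le)
  have hTS : T ≤ S := hT.trans (Multiset.filter_le _ S)
  obtain ⟨R, rfl⟩ := Multiset.le_iff_exists_add.mp hTS
  have hT0 : T ≠ 0 := by
    rintro rfl
    exact hp.ne_zero (by simpa using hTcard.symm)
  have hTord : ∀ g ∈ T, addOrderOf g = d := fun g hg =>
    (Multiset.mem_filter.mp (Multiset.mem_of_le hT hg)).2
  have hquot : 0 < d / d.minFac := Nat.div_pos (Nat.minFac_le hd0) hp.pos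
  have hord : addOrderOf T.sum ∣ d / d.minFac := addOrderOf_dvd_of_nsmul_eq_zero hTsum
  have hle : crossNumber (T + R) ≤ crossNumber (T.sum ::ₘ R) := by
    rw [crossNumber_add, crossNumber_cons, crossNumber_of_addOrderOf_eq hTord, hTcard]
    refine add_le_add_left ?_ _
    have hpos : 0 < addOrderOf T.sum := Nat.pos_of_dvd_of_pos hord hquot
    rw [div_le_div_iff₀ (by exact_mod_cast hd0) (by exact_mod_cast hpos), one_mul]
    have := Nat.mul_le_mul_left d.minFac (Nat.le_of_dvd hquot hord)
    rw [Nat.mul_div_cancel' hpd] at this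
    exact_mod_cast this
  refine hle.trans (ih _ ?_ _ (hS.sum_cons hT0) rfl)
  rw [Multiset.card_cons, ← hk, Multiset.card_add, hTcard]
  have := hp.two_le
  omega

theorem map_multiset_sum_eq_count_nsmul {G H : Type*} [AddCommGroup G] [AddCommGroup H]
    (f : G →+ H) (y : G) (T : Multiset G) (h : ∀ g ∈ T, g ≠ y → f g = 0) :
    f T.sum = T.countP (fun g => g = y) • f y := by
  induction T using Multiset.induction_on with
  | empty => simp
  | cons g T ih =>
    rw [Multiset.sum_cons, map_add, ih fun x hx => h x (Multiset.mem_cons_of_mem hx),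
      Multiset.countP_cons, add_nsmul, add_comm]
    congr 1
    split_ifs with hg
    · rw [hg, one_nsmul]
    · rw [h g (Multiset.mem_cons_self g T) hg, zero_nsmul]

theorem crossNumber_sum {G ι : Type*} [AddCommGroup G] (s : Finset ι) (F : ι → Multiset G) :
    crossNumber (∑ x ∈ s, F x) = ∑ x ∈ s, crossNumber (F x) :=
  map_sum (⟨⟨crossNumber, by simp [crossNumber]⟩, crossNumber_add⟩ : Multiset G →+ ℝ) F s

/-- The standard element of order `p` in the `i`-th coordinate of `C_n ^ r`. -/
def primeOrderElement (r n : ℕ) (x : Fin r × ℕ) : Fin r → ZMod n :=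
  Pi.single x.1 ((n / x.2 : ℕ) : ZMod n)

/-- The sequence containing each `primeOrderElement` of order `p` exactly `p - 1` times. -/
def standardSequence (r n : ℕ) : Multiset (Fin r → ZMod n) :=
  ∑ x ∈ (Finset.univ : Finset (Fin r)) ×ˢ n.primeFactors,
    Multiset.replicate (x.2 - 1) (primeOrderElement r n x)

theorem addOrderOf_primeOrderElement {r n : ℕ} [NeZero n] {x : Fin r × ℕ}
    (hx : x.2 ∈ n.primeFactors) : addOrderOf (primeOrderElement r n x) = x.2 := by
  have hp := Nat.prime_of_mem_primeFactors hx
  have hd := Nat.dvd_of_mem_primeFactors hx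
  have : Fact x.2.Prime := ⟨hp⟩
  have hn : 0 < n := Nat.pos_of_ne_zero (NeZero.ne n)
  refine addOrderOf_eq_prime ?_ fun h => ?_
  · rw [primeOrderElement, ← Pi.single_smul', nsmul_eq_mul, ← Nat.cast_mul,
      Nat.mul_div_cancel' hd, ZMod.natCast_self, Pi.single_zero]
  · rw [primeOrderElement, Pi.single_eq_zero_iff, ZMod.natCast_eq_zero_iff] at h
    exact (Nat.div_lt_self hn hp.one_lt).not_ge
      (Nat.le_of_dvd (Nat.div_pos (Nat.le_of_dvd hn hd) hp.pos) h)

/-- The homomorphism isolating the `i`-th coordinate and the prime `p`. -/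
def primeProjection (r n : ℕ) (x : Fin r × ℕ) : (Fin r → ZMod n) →+ ZMod n :=
  (nsmulAddMonoidHom (∏ q ∈ n.primeFactors.erase x.2, q)).comp
    (Pi.evalAddMonoidHom (fun _ => ZMod n) x.1)

theorem primeProjection_primeOrderElement_of_ne {r n : ℕ} {x y : Fin r × ℕ}
    (hy : y.2 ∈ n.primeFactors) (hxy : y ≠ x) :
    primeProjection r n x (primeOrderElement r n y) = 0 := by
  simp only [primeProjection, primeOrderElement, AddMonoidHom.comp_apply,
    Pi.evalAddMonoidHom_apply, nsmulAddMonoidHom_apply]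
  by_cases h1 : y.1 = x.1
  · have h2 : y.2 ≠ x.2 := fun h2 => hxy (Prod.ext h1 h2)
    rw [h1, Pi.single_eq_same, nsmul_eq_mul, ← Nat.cast_mul, ZMod.natCast_eq_zero_iff]
    have hq : y.2 ∣ ∏ q ∈ n.primeFactors.erase x.2, q :=
      Finset.dvd_prod_of_mem (fun q => q) (Finset.mem_erase.mpr ⟨h2, hy⟩)
    calc n = y.2 * (n / y.2) := (Nat.mul_div_cancel' (Nat.dvd_of_mem_primeFactors hy)).symm
      _ ∣ _ := Nat.mul_dvd_mul_right hq _
  · rw [Pi.single_eq_of_ne (Ne.symm h1), nsmul_zero]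

theorem dvd_of_nsmul_primeProjection_eq_zero {r n k : ℕ} [NeZero n] {x : Fin r × ℕ}
    (hx : x.2 ∈ n.primeFactors)
    (h : k • primeProjection r n x (primeOrderElement r n x) = 0) : x.2 ∣ k := by
  have hp := Nat.prime_of_mem_primeFactors hx
  have hd := Nat.dvd_of_mem_primeFactors hx
  have hn : 0 < n := Nat.pos_of_ne_zero (NeZero.ne n)
  simp only [primeProjection, primeOrderElement, AddMonoidHom.comp_apply,
    Pi.evalAddMonoidHom_apply, nsmulAddMonoidHom_apply, Pi.single_eq_same] at h
  rw [nsmul_eq_mul, nsmul_eq_mul, ← Nat.cast_mul, ← Nat.cast_mul, ZMod.natCast_eq_zero_iff,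
    ← mul_assoc] at h
  have hquot : 0 < n / x.2 := Nat.div_pos (Nat.le_of_dvd hn hd) hp.pos
  have h' : x.2 * (n / x.2) ∣ k * (∏ q ∈ n.primeFactors.erase x.2, q) * (n / x.2) := by
    rwa [Nat.mul_div_cancel' hd]
  rcases hp.dvd_mul.mp (Nat.dvd_of_mul_dvd_mul_right hquot h') with h | h
  · exact h
  · obtain ⟨q, hq, hdvd⟩ := (Prime.dvd_finsetProd_iff hp.prime _).mp h
    obtain ⟨hne, hq⟩ := Finset.mem_erase.mp hq
    exact absurd ((Nat.prime_dvd_prime_iff_eq hp (Nat.prime_of_mem_primeFactors hq)).mp hdvd).symm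
      hne

theorem isZeroSumFree_standardSequence (r n : ℕ) [NeZero n] :
    IsZeroSumFree (standardSequence r n) := by
  intro T hT hT0 hsum
  have hmem : ∀ g ∈ T, ∃ x : Fin r × ℕ, x.2 ∈ n.primeFactors ∧ g = primeOrderElement r n x := by
    intro g hg
    obtain ⟨x, hx, hgx⟩ := Multiset.mem_sum.mp (Multiset.mem_of_le hT hg)
    exact ⟨x, (Finset.mem_product.mp hx).2, Multiset.eq_of_mem_replicate hgx⟩
  obtain ⟨y, hy⟩ := Multiset.exists_mem_of_ne_zero hT0
  obtain ⟨x, hx, rfl⟩ := hmem y hy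
  have hp := Nat.prime_of_mem_primeFactors hx
  have hmap := map_multiset_sum_eq_count_nsmul (primeProjection r n x) (primeOrderElement r n x) T
    fun g hg hne => by
      obtain ⟨z, hz, rfl⟩ := hmem g hg
      exact primeProjection_primeOrderElement_of_ne hz fun h => hne (h ▸ rfl)
  rw [hsum, map_zero] at hmap
  have hdvd := dvd_of_nsmul_primeProjection_eq_zero hx hmap.symm
  have hpos : 0 < T.countP (fun g => g = primeOrderElement r n x) :=
    Multiset.countP_pos.mpr ⟨_, hy, rfl⟩
  have hcount : (standardSequence r n).countP (fun g => g = primeOrderElement r n x) ≤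
      x.2 - 1 := by
    rw [standardSequence, ← Multiset.coe_countPAddMonoidHom, map_sum,
      Finset.sum_eq_single_of_mem x (Finset.mem_product.mpr ⟨Finset.mem_univ _, hx⟩)]
    · rw [Multiset.coe_countPAddMonoidHom]
      exact (Multiset.countP_le_card _ _).trans (Multiset.card_replicate _ _).le
    · intro z hz hzx
      rw [Multiset.coe_countPAddMonoidHom, Multiset.countP_eq_zero]
      intro g hg hgx
      rw [Multiset.eq_of_mem_replicate hg] at hgx
      have h0 := primeProjection_primeOrderElement_of_ne (x := x)
        (Finset.mem_product.mp hz).2 hzx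
      rw [hgx] at h0
      have := dvd_of_nsmul_primeProjection_eq_zero (k := 1) hx (by rw [h0, nsmul_zero])
      exact hp.one_lt.not_ge (Nat.le_of_dvd one_pos this)
  have h1 := Nat.le_of_dvd hpos (by convert! hdvd)
  have h2 := (Multiset.countP_le_of_le _ hT).trans hcount
  have := hp.pos
  omega

theorem crossNumber_standardSequence (r n : ℕ) [NeZero n] :
    crossNumber (standardSequence r n) =
      r * (n.primeFactors.card - ∑ p ∈ n.primeFactors, (p : ℝ)⁻¹) := by
  rw [standardSequence, crossNumber_sum, Finset.sum_product]
  have hterm : ∀ (i : Fin r), ∀ p ∈ n.primeFactors,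
      crossNumber (Multiset.replicate (p - 1) (primeOrderElement r n (i, p))) =
        1 - (p : ℝ)⁻¹ := by
    intro i p hp
    have hpp := Nat.prime_of_mem_primeFactors hp
    rw [crossNumber_of_addOrderOf_eq (d := p) fun g hg => by
      rw [Multiset.eq_of_mem_replicate hg]
      exact addOrderOf_primeOrderElement (x := (i, p)) hp, Multiset.card_replicate,
      Nat.cast_sub hpp.one_le, Nat.cast_one, sub_div, one_div,
      div_self (by exact_mod_cast hpp.ne_zero)]
  rw [Finset.sum_congr rfl fun i _ => Finset.sum_congr rfl (hterm i)]
  simp [mul_sub]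

theorem abs_littleCrossNumber_sub_le (r : ℕ) : ∃ C : ℝ, 0 < C ∧ ∀ (n : ℕ) [NeZero n],
    |littleCrossNumber (Fin r → ZMod n) - r * n.primeFactors.card| ≤
      C * (tailEulerSum n.primeFactors - n.primeFactors.card) := by
  obtain ⟨c, hc⟩ := exists_const_crossNumber_le r
  refine ⟨r + c + 1, by positivity, fun n _ => ?_⟩
  have hinv := sum_inv_le_tailEulerSum_sub_card (P := n.primeFactors)
    fun p hp => Nat.prime_of_mem_primeFactors hp
  have hnonneg : 0 ≤ tailEulerSum n.primeFactors - n.primeFactors.card :=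
    (Finset.sum_nonneg fun p _ => by positivity).trans hinv
  have hbound : ∀ x ∈ {x : ℝ | ∃ S : Multiset (Fin r → ZMod n),
      IsZeroSumFree S ∧ crossNumber S = x},
      x ≤ r * n.primeFactors.card + c * (tailEulerSum n.primeFactors - n.primeFactors.card) := by
    rintro x ⟨S, hS, rfl⟩
    exact hc n S hS
  have hstd := isZeroSumFree_standardSequence r n
  have hmem : crossNumber (standardSequence r n) ∈ {x : ℝ | ∃ S : Multiset (Fin r → ZMod n),
      IsZeroSumFree S ∧ crossNumber S = x} := ⟨_, hstd, rfl⟩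
  have hupper := csSup_le ⟨_, hmem⟩ hbound
  have hlower := le_csSup ⟨_, hbound⟩ hmem
  rw [crossNumber_standardSequence] at hlower
  have hr := mul_le_mul_of_nonneg_left hinv (Nat.cast_nonneg (α := ℝ) r)
  have h1 := mul_nonneg (Nat.cast_nonneg (α := ℝ) r) hnonneg
  have h2 := mul_nonneg (Nat.cast_nonneg (α := ℝ) c) hnonneg
  rw [littleCrossNumber, abs_le]
  constructor <;> linarith

theorem stmt17 (r : ℕ) (hr : 1 ≤ r) :
    ∀ ε : ℝ, 0 < ε → ∃ N : ℕ, ∀ n : ℕ, 2 ≤ n → N ≤ n.primeFactors.card →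
      |littleCrossNumber (Fin r → ZMod n) / (n.primeFactors.card : ℝ) - r| < ε := by
  intro ε hε
  obtain ⟨C, hC, hbound⟩ := abs_littleCrossNumber_sub_le r
  obtain ⟨N, hN⟩ := exists_tailEulerSum_sub_card_le (ε := ε / (2 * C)) (by positivity)
  refine ⟨max N 1, fun n hn hω => ?_⟩
  have : NeZero n := ⟨by omega⟩
  have hpos : (0 : ℝ) < n.primeFactors.card := by
    exact_mod_cast lt_of_lt_of_le one_pos ((le_max_right N 1).trans hω)
  have htail := hN n.primeFactors (fun p hp => Nat.prime_of_mem_primeFactors hp)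
    ((le_max_left N 1).trans hω)
  have h := (hbound n).trans (mul_le_mul_of_nonneg_left htail hC.le)
  have hhalf : C * (ε / (2 * C) * n.primeFactors.card) = ε / 2 * n.primeFactors.card := by
    field_simp
  rw [hhalf] at h
  rw [div_sub' hpos.ne', abs_div, abs_of_pos hpos, div_lt_iff₀ hpos, mul_comm (_ : ℝ) (r : ℝ)]
  exact h.trans_lt (by nlinarith)
end
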